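/- Let G be a primitive divergent graph. (i) For p = 2 and any s ≥ 1 with q = 2^s, assuming 4 divides [Ψ_G]_2 and q² divides [Ψ_G]_q, one has [Ψ_G]_q / q² ≡ [Ψ_G]_2 / 4 (mod 2). (ii) For any prime p, taking s = p and q = p^p, assuming p² divides [Ψ_G]_p and q² divides [Ψ_G]_q, one has [Ψ_G]_q / q² ≡ [Ψ_G]_p / p² (mod p). That is, c₂^{(q)}(G) ≡ c₂^{(p)}(G) (mod p) in both cases. -/

import Mathlib

open MvPolynomial

/-- The number of points `x ∈ 𝔽_q^σ`, `q = p^s`, at which the integer polynomial `F`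
vanishes (coefficients mapped into the field canonically). -/
noncomputable def pointCount {σ : Type} (p s : ℕ) [Fact p.Prime] (F : MvPolynomial σ ℤ) : ℕ :=
  Nat.card {x : σ → GaloisField p s // MvPolynomial.aeval x F = 0}

-- The Kirchhoff polynomial `Ψ_G = ∑_T ∏_{e ∉ T} α_e`, the sum over spanning trees `T`
-- of `G`, a polynomial in variables indexed by the edges of `G`.
open Classical in
noncomputable def kirchhoff {V : Type} [Fintype V] [DecidableEq V]
    (G : SimpleGraph V) [DecidableRel G.Adj] : MvPolynomial ↥G.edgeFinset ℤ :=
  ∑ T ∈ G.edgeFinset.powerset.filter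
      (fun T => (SimpleGraph.fromEdgeSet (T : Set (Sym2 V))).IsTree),
    ∏ e ∈ Finset.univ.filter (fun e : ↥G.edgeFinset => (e : Sym2 V) ∉ T), X e

/-- A graph is internally 6-edge-connected if removing any set of at most 5 edges
results in at most one connected component containing an edge. -/
def InternallySixEdgeConnected {W : Type} (K : SimpleGraph W) : Prop :=
  ∀ S : Finset (Sym2 W), (S : Set (Sym2 W)) ⊆ K.edgeSet → S.card ≤ 5 →
    ∀ a b c d : W, (K.deleteEdges (S : Set (Sym2 W))).Adj a b →
      (K.deleteEdges (S : Set (Sym2 W))).Adj c d →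
      (K.deleteEdges (S : Set (Sym2 W))).Reachable a c

/-- `G` is primitive divergent: `G` is connected and is the decompletion `K - v` of a
connected, 4-regular, internally 6-edge-connected simple graph `K` (here realized on
vertex set `Option V` with deleted vertex `none`). -/
def IsPrimitiveDivergent {V : Type} [Fintype V] (G : SimpleGraph V) : Prop :=
  G.Connected ∧
  ∃ K : SimpleGraph (Option V),
    K.Connected ∧ (∀ w, (K.neighborSet w).ncard = 4) ∧
    InternallySixEdgeConnected K ∧
    ∀ a b : V, K.Adj (some a) (some b) ↔ G.Adj a b

namespace C2

lemma card_fib {X Y : Type*} [Fintype X] [Fintype Y] (R : Y → X → Prop) :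
    Nat.card {yx : Y × X // R yx.1 yx.2} = ∑ x, Nat.card {y // R y x} := by
  classical
  rw [← Nat.card_sigma]
  refine Nat.card_congr ⟨fun z => ⟨z.1.2, ⟨z.1.1, z.2⟩⟩, fun z => ⟨(z.2.1, z.1), z.2.2⟩, fun _ => rfl, fun _ => rfl⟩

lemma card_lin_one {F : Type*} [Field F] [Fintype F] [DecidableEq F] (a b : F) :
    Nat.card {z : F // z * a + b = 0} = if a = 0 then (if b = 0 then Fintype.card F else 0) else 1 := by
  split_ifs with ha hb
  · simp [ha, hb]
  · simp [ha, hb]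
  · rw [Nat.card_eq_one_iff_unique]
    refine ⟨⟨fun x y => ?_⟩, ⟨⟨-b/a, by field_simp; ring⟩⟩⟩
    apply Subtype.ext
    have := x.2.trans y.2.symm
    exact mul_right_cancel₀ ha (add_right_cancel this)

lemma card_lin {F X : Type*} [Field F] [Fintype F] [Fintype X] (A B : X → F) :
    Nat.card {zx : F × X // zx.1 * A zx.2 + B zx.2 = 0} + Nat.card {x // A x = 0} =
      Fintype.card F * Nat.card {x // A x = 0 ∧ B x = 0} + Fintype.card X := by
  classical
  rw [card_fib (fun z x => z * A x + B x = 0)]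
  simp only [card_lin_one]
  simp only [Nat.card_eq_fintype_card, Fintype.card_subtype, Finset.card_filter]
  rw [← Finset.sum_add_distrib, Finset.mul_sum, Fintype.card_eq_sum_ones (α := X), ← Finset.sum_add_distrib]
  refine Finset.sum_congr rfl fun x _ => ?_
  by_cases h1 : A x = 0 <;> by_cases h2 : B x = 0 <;> simp [h1, h2]

lemma card_quad {F : Type*} [Field F] [Fintype F] (d P R m T : F) (h : d * T = P * R - m^2)
    (hne : ¬ (d = 0 ∧ P = 0 ∧ R = 0 ∧ m = 0)) :
    Nat.card {x : F × F × F // d*(x.2.1*x.2.2 + x.2.1*x.1 + x.2.2*x.1) - x.2.1 * R - x.2.2 * P - x.1*(P+R-2*m) + T = 0}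
      = Fintype.card F ^ 2 := by
  classical
  set q := Fintype.card F with hq
  have key := card_lin (F := F) (X := F × F) (fun x => d*(x.1+x.2) - (P+R-2*m))
     (fun x => d*(x.1*x.2) - x.1*R - x.2*P + T)
  have e : ∀ x : F × F × F, d*(x.2.1*x.2.2 + x.2.1*x.1 + x.2.2*x.1) - x.2.1 * R - x.2.2 * P - x.1*(P+R-2*m) + T
     = x.1 * (d*(x.2.1+x.2.2) - (P+R-2*m)) + (d*(x.2.1*x.2.2) - x.2.1*R - x.2.2*P + T) := by
    intro x; ring
  simp only [e]
  rw [Fintype.card_prod, ← hq] at key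
  by_cases hd : d = 0
  · subst hd
    by_cases hS : P+R-2*m = 0
    · -- linear in the other two
      have key2 := card_lin (F := F) (X := F) (fun x => -R) (fun x => 0 * 0 - x*P + T)
      have h3 : ¬ (R = 0 ∧ P = 0) := by
        rintro ⟨rfl, rfl⟩
        apply hne
        refine ⟨rfl, rfl, rfl, ?_⟩
        have : m^2 = 0 := by linear_combination h
        exact pow_eq_zero_iff (two_ne_zero) |>.1 this
      have key3 := card_lin_one (-P) T
      have e2 : Nat.card {x : F × F // 0 * (x.1+x.2) - (P+R-2*m) = 0 ∧ 0*(x.1*x.2) - x.1*R - x.2*P + T = 0}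
        = Nat.card {zx : F × F // zx.1 * -R + (0 * 0 - zx.2*P + T) = 0} := by
        apply Nat.card_congr
        apply Equiv.subtypeEquivRight
        intro x
        constructor
        · rintro ⟨-, hx⟩; linear_combination hx
        · intro hx; exact ⟨by rw [hS]; ring, by linear_combination hx⟩
      have e3 : Nat.card {x : F // x * (-P) + T = 0} = Nat.card {x : F // 0 * 0 - x*P + T = 0} := by
        apply Nat.card_congr
        apply Equiv.subtypeEquivRight
        intro x
        rw [show x * (-P) + T = 0 * 0 - x*P + T by ring]
      rw [e2] at key
      have e4 : Nat.card {x : F × F // 0 * (x.1+x.2) - (P+R-2*m) = 0} = q * q := by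
        simp [hS, hq]
      rw [e4] at key
      have : Nat.card {zx : F × F // zx.1 * -R + (0 * 0 - zx.2*P + T) = 0} = q := by
        by_cases hR : R = 0
        · have hP : P ≠ 0 := fun hP => h3 ⟨hR, hP⟩
          rw [if_neg (neg_ne_zero.2 hP)] at key3
          rw [e3] at key3
          simp only [hR, neg_zero, true_and, key3] at key2
          simp only [hR, neg_zero]
          have : Nat.card {x : F // True} = q := by simp [hq]
          rw [this] at key2
          omega
        · have e5 : ∀ x : F, ¬ (-R = 0) := fun _ => neg_ne_zero.2 hR
          simp only [neg_ne_zero.2 hR, false_and] at key2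
          simp at key2
          simpa [hq] using key2
      rw [this] at key
      rw [pow_two]; omega
    · have e5 : ∀ x : F × F, ¬ (0 * (x.1+x.2) - (P+R-2*m) = 0) := by
        intro x hx; apply hS; linear_combination -hx
      simp only [e5, false_and] at key
      rw [pow_two]
      simpa using key
  · have c1 : Nat.card {x : F × F // d * (x.1+x.2) - (P+R-2*m) = 0} = q := by
      rw [hq, ← Nat.card_eq_fintype_card]
      refine Nat.card_congr ⟨fun x => x.1.1, fun x => ⟨(x, (P+R-2*m)/d - x), ?_⟩, ?_, ?_⟩
      · field_simp; ring
      · rintro ⟨⟨x, y⟩, hx⟩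
        apply Subtype.ext
        refine Prod.ext rfl ?_
        simp only at hx ⊢
        field_simp
        linear_combination -hx
      · intro x; rfl
    have c2 : Nat.card {x : F × F // d * (x.1+x.2) - (P+R-2*m) = 0 ∧ d*(x.1*x.2) - x.1*R - x.2*P + T = 0} = 1 := by
      rw [Nat.card_eq_one_iff_unique]
      have hx0 : ∀ x y : F, d * (x+y) - (P+R-2*m) = 0 → d*(x*y) - x*R - y*P + T = 0 → d * x - P + m = 0 := by
        intro x y h1 h2
        have : (d*x - P + m)^2 = 0 := by
          linear_combination (-d) * h2 + (d * x - P) * h1 + h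
        exact pow_eq_zero_iff (two_ne_zero) |>.1 this
      refine ⟨⟨?_⟩, ⟨⟨((P-m)/d, (R - m)/d), ?_, ?_⟩⟩⟩
      · rintro ⟨⟨x, y⟩, h1, h2⟩ ⟨⟨x', y'⟩, h1', h2'⟩
        have a1 := hx0 _ _ h1 h2
        have a2 := hx0 _ _ h1' h2'
        simp only at h1 h1'
        have : x = x' := mul_left_cancel₀ hd (by linear_combination a1 - a2)
        subst this
        have : y = y' := mul_left_cancel₀ hd (by linear_combination h1 - h1')
        subst this
        rfl
      · field_simp; ring
      · field_simp; linear_combination h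
    rw [c1, c2] at key
    rw [pow_two]; omega

end C2

namespace C2
open Matrix

section LA
variable {n : Type*} [Fintype n] [DecidableEq n] {R S : Type*} [CommRing R] [CommRing S]

def bm4 (b : Fin 3 → n → R) : Matrix (Fin 4) n R := Matrix.of ![b 0, b 1, b 2, 0]
def bm3 (b : Fin 3 → n → R) : Matrix (Fin 3) n R := Matrix.of ![b 0, b 1, 0]
def bm2 (b : Fin 3 → n → R) : Matrix (Fin 2) n R := Matrix.of ![b 0 - b 2, b 1 - b 2]
def bm1 (b : Fin 3 → n → R) : Matrix (Fin 1) n R := Matrix.of ![b 0]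

def D4 (Q : Matrix n n R) (b : Fin 3 → n → R) (x : Fin 3 → R) : R :=
  (fromBlocks !![x 0,0,0,1;0,x 1,0,1;0,0,x 2,1;1,1,1,0] (bm4 b) (bm4 b)ᵀ Q).det
def D3 (Q : Matrix n n R) (b : Fin 3 → n → R) (x : Fin 3 → R) : R :=
  (fromBlocks !![x 0,0,1;0,x 1,1;1,1,0] (bm3 b) (bm3 b)ᵀ Q).det
def D2 (Q : Matrix n n R) (b : Fin 3 → n → R) : R :=
  (fromBlocks 0 (bm2 b) (bm2 b)ᵀ Q).det
def D1 (Q : Matrix n n R) (b : Fin 3 → n → R) (x : Fin 3 → R) : R :=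
  (fromBlocks !![x 0] (bm1 b) (bm1 b)ᵀ Q).det
def pr (Q : Matrix n n R) (u w : n → R) : R := u ⬝ᵥ (adjugate Q *ᵥ w)

lemma map_D4 (φ : R →+* S) (Q : Matrix n n R) (b : Fin 3 → n → R) (x : Fin 3 → R) :
    φ (D4 Q b x) = D4 (Q.map φ) (fun i j => φ (b i j)) (fun i => φ (x i)) := by
  rw [D4, D4, RingHom.map_det, RingHom.mapMatrix_apply, fromBlocks_map]
  congr 2
  · ext i j; fin_cases i <;> fin_cases j <;> simp
  · ext i j; fin_cases i <;> simp [bm4]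
  · ext i j; fin_cases j <;> simp [bm4]

lemma map_D3 (φ : R →+* S) (Q : Matrix n n R) (b : Fin 3 → n → R) (x : Fin 3 → R) :
    φ (D3 Q b x) = D3 (Q.map φ) (fun i j => φ (b i j)) (fun i => φ (x i)) := by
  rw [D3, D3, RingHom.map_det, RingHom.mapMatrix_apply, fromBlocks_map]
  congr 2
  · ext i j; fin_cases i <;> fin_cases j <;> simp
  · ext i j; fin_cases i <;> simp [bm3]
  · ext i j; fin_cases j <;> simp [bm3]

lemma map_D1 (φ : R →+* S) (Q : Matrix n n R) (b : Fin 3 → n → R) (x : Fin 3 → R) :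
    φ (D1 Q b x) = D1 (Q.map φ) (fun i j => φ (b i j)) (fun i => φ (x i)) := by
  rw [D1, D1, RingHom.map_det, RingHom.mapMatrix_apply, fromBlocks_map]
  congr 2
  · ext i j; fin_cases i; fin_cases j; simp
  · ext i j; fin_cases i; simp [bm1]
  · ext i j; fin_cases j; simp [bm1]

lemma map_D2 (φ : R →+* S) (Q : Matrix n n R) (b : Fin 3 → n → R) :
    φ (D2 Q b) = D2 (Q.map φ) (fun i j => φ (b i j)) := by
  rw [D2, D2, RingHom.map_det, RingHom.mapMatrix_apply, fromBlocks_map]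
  congr 2
  · ext i j; simp
  · ext i j; fin_cases i <;> simp [bm2]
  · ext i j; fin_cases j <;> simp [bm2]

lemma map_pr (φ : R →+* S) (Q : Matrix n n R) (u w : n → R) :
    φ (pr Q u w) = pr (Q.map φ) (fun i => φ (u i)) (fun i => φ (w i)) := by
  have := RingHom.map_adjugate φ Q
  rw [RingHom.mapMatrix_apply, RingHom.mapMatrix_apply] at this
  simp only [pr, ← this, dotProduct, mulVec, map_sum, map_mul, map_apply]

lemma pr_symm (Q : Matrix n n R) (hQ : Qᵀ = Q) (u w : n → R) : pr Q u w = pr Q w u := by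
  have : (adjugate Q)ᵀ = adjugate Q := by rw [adjugate_transpose, hQ]
  rw [pr, pr, dotProduct_mulVec, dotProduct_comm, ← mulVec_transpose, this]

lemma pr_sub_left (Q : Matrix n n R) (u v w : n → R) : pr Q (u - v) w = pr Q u w - pr Q v w := by
  simp [pr, sub_dotProduct]
lemma pr_sub_right (Q : Matrix n n R) (u v w : n → R) : pr Q w (u - v) = pr Q w u - pr Q w v := by
  simp [pr, mulVec_sub, dotProduct_sub]

def Idents (Q : Matrix n n R) (b : Fin 3 → n → R) (x : Fin 3 → R) : Prop :=
  (D4 Q b x = -(Q.det * (x 0 * x 1 + x 0 * x 2 + x 1 * x 2) - x 0 * pr Q (b 1 - b 2) (b 1 - b 2)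
     - x 1 * pr Q (b 0 - b 2) (b 0 - b 2) - x 2 * (pr Q (b 0 - b 2) (b 0 - b 2) + pr Q (b 1 - b 2) (b 1 - b 2)
       - 2 * pr Q (b 0 - b 2) (b 1 - b 2)) + D2 Q b)) ∧
  (Q.det * D2 Q b = pr Q (b 0 - b 2) (b 0 - b 2) * pr Q (b 1 - b 2) (b 1 - b 2) - pr Q (b 0 - b 2) (b 1 - b 2) ^ 2) ∧
  (D3 Q b x = -((x 0 + x 1) * Q.det - pr Q (b 0 - b 1) (b 0 - b 1))) ∧
  (D1 Q b x = x 0 * Q.det - pr Q (b 0) (b 0))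

lemma det4 (a b c d e f : R) : (!![a, d, e, 1; d, b, f, 1; e, f, c, 1; 1, 1, 1, 0] : Matrix (Fin 4) (Fin 4) R).det =
    -((a + c - 2 * e) * (b + c - 2 * f) - (c + d - e - f)^2) := by
  rw [det_succ_row_zero]
  simp [Fin.sum_univ_succ, det_fin_three, Fin.succAbove, submatrix]
  ring

lemma idents_of_ne {F : Type*} [Field F] (Q : Matrix n n F) (hQ : Qᵀ = Q) (hd : Q.det ≠ 0)
    (b : Fin 3 → n → F) (x : Fin 3 → F) : Idents Q b x := by
  have hu : IsUnit Q.det := isUnit_iff_ne_zero.2 hd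
  let _ := invertibleOfIsUnitDet Q hu
  set s : (n → F) → (n → F) → F := fun u w => u ⬝ᵥ (Q⁻¹ *ᵥ w) with hs
  have hpr : ∀ u w, pr Q u w = Q.det * s u w := by
    intro u w
    have : adjugate Q = Q.det • Q⁻¹ := by
      rw [Matrix.inv_def, smul_smul, Ring.mul_inverse_cancel _ hu, one_smul]
    simp only [pr, this, hs, smul_mulVec, dotProduct_smul, smul_eq_mul]
  have hsy : ∀ u w, s u w = s w u := by
    intro u w
    have := pr_symm Q hQ u w
    rw [hpr, hpr] at this
    exact mul_left_cancel₀ hd this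
  have hsl : ∀ u v w, s (u - v) w = s u w - s v w := by
    intro u v w; simp [hs, sub_dotProduct]
  have hsr : ∀ u v w, s w (u - v) = s w u - s w v := by
    intro u v w; simp [hs, mulVec_sub, dotProduct_sub]
  have hs0 : ∀ u, s u 0 = 0 := by intro u; simp [hs]
  have hs0' : ∀ u, s 0 u = 0 := by intro u; simp [hs]
  have hprod : ∀ {k : ℕ} (c : Matrix (Fin k) n F), c * ⅟Q * cᵀ = Matrix.of fun i j => s (c i) (c j) := by
    intro k c
    ext i j
    rw [invOf_eq_nonsing_inv, Matrix.mul_assoc, Matrix.mul_apply]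
    rfl
  have q0 : bm4 b 0 = b 0 := rfl
  have q1 : bm4 b 1 = b 1 := rfl
  have q2 : bm4 b 2 = b 2 := rfl
  have q3 : bm4 b 3 = 0 := rfl
  have r0 : bm3 b 0 = b 0 := rfl
  have r1 : bm3 b 1 = b 1 := rfl
  have r2 : bm3 b 2 = 0 := rfl
  have t0 : bm2 b 0 = b 0 - b 2 := rfl
  have t1 : bm2 b 1 = b 1 - b 2 := rfl
  have w0 : bm1 b 0 = b 0 := rfl
  refine ⟨?_, ?_, ?_, ?_⟩
  · rw [D4, det_fromBlocks₂₂, hprod, D2, det_fromBlocks₂₂, hprod, det_fin_two]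
    have h4 : (!![x 0,0,0,1;0,x 1,0,1;0,0,x 2,1;1,1,1,0] - Matrix.of fun i j => s (bm4 b i) (bm4 b j)) =
      !![x 0 - s (b 0) (b 0), - s (b 0) (b 1), - s (b 0) (b 2), 1;
         - s (b 0) (b 1), x 1 - s (b 1) (b 1), - s (b 1) (b 2), 1;
         - s (b 0) (b 2), - s (b 1) (b 2), x 2 - s (b 2) (b 2), 1;
         1, 1, 1, 0] := by
      ext i j
      fin_cases i <;> fin_cases j <;> simp [q0, q1, q2, q3, hs0, hs0', hsy (b 1) (b 0), hsy (b 2) (b 0), hsy (b 2) (b 1)]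
    rw [h4, det4]
    simp [t0, t1, hpr, hsl, hsr]
    rw [hsy (b 1) (b 0), hsy (b 2) (b 0), hsy (b 2) (b 1)]
    ring
  · rw [D2, det_fromBlocks₂₂, hprod, det_fin_two]
    simp [t0, t1, hpr, hsl, hsr]
    rw [hsy (b 1) (b 0), hsy (b 2) (b 0), hsy (b 2) (b 1)]
    ring
  · rw [D3, det_fromBlocks₂₂, hprod, det_fin_three]
    simp [r0, r1, r2, hs0, hs0', hpr, hsl, hsr]
    rw [hsy (b 1) (b 0)]
    ring
  · rw [D1, det_fromBlocks₂₂, hprod, det_fin_one, Matrix.sub_apply, of_apply, of_apply, w0, hpr]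
    simp
    ring

lemma idents {F : Type*} [Field F] (Q : Matrix n n F) (hQ : Qᵀ = Q)
    (b : Fin 3 → n → F) (x : Fin 3 → F) : Idents Q b x := by
  classical
  let Qt : Matrix n n (Polynomial F) := Q.map Polynomial.C + (Polynomial.X : Polynomial F) • 1
  let bt : Fin 3 → n → Polynomial F := fun i j => Polynomial.C (b i j)
  let xt : Fin 3 → Polynomial F := fun i => Polynomial.C (x i)
  have hdet : Qt.det ≠ 0 := by
    have h1 : Qt = charmatrix (-Q) := by
      ext i j
      simp [Qt, charmatrix, Matrix.smul_apply, Matrix.one_apply, Matrix.diagonal_apply]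
      split_ifs <;> ring_nf
    rw [h1]
    exact (Matrix.charpoly_monic (-Q)).ne_zero
  have hsym : Qtᵀ = Qt := by
    have : ∀ i j, Q i j = Q j i := fun i j => by conv_lhs => rw [← hQ, transpose_apply]
    ext i j
    simp [Qt, Matrix.one_apply, this i j, eq_comm]
  let K := FractionRing (Polynomial F)
  let φ : Polynomial F →+* K := algebraMap _ _
  have hφ : Function.Injective φ := IsFractionRing.injective _ _
  have key := idents_of_ne (Qt.map φ) (by rw [← transpose_map, hsym]) (by
    have := RingHom.map_det φ Qt
    rw [RingHom.mapMatrix_apply] at this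
    rw [← this]
    exact fun h => hdet (hφ (h.trans (map_zero _).symm))) (fun i j => φ (bt i j)) (fun i => φ (xt i))
  have hsubf : ∀ (i j : Fin 3), ((fun k => φ (bt i k)) - fun k => φ (bt j k)) = fun k => φ ((bt i - bt j) k) := by
    intros; ext; simp
  have poly : Idents Qt bt xt := by
    have hd : (Qt.map φ).det = φ Qt.det := by rw [RingHom.map_det, RingHom.mapMatrix_apply]
    unfold Idents at key ⊢
    simp only [hsubf] at key
    simp only [← map_D4, ← map_D3, ← map_D2, ← map_D1, ← map_pr, hd] at key
    obtain ⟨k1, k2, k3, k4⟩ := key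
    refine ⟨hφ ?_, hφ ?_, hφ ?_, hφ ?_⟩
    · simpa [show φ 2 = 2 from map_ofNat φ 2] using k1
    · simpa using k2
    · simpa using k3
    · simpa using k4
  let ψ : Polynomial F →+* F := Polynomial.evalRingHom 0
  have hQ' : Qt.map ψ = Q := by
    ext i j; simp [Qt, ψ]
  have hb : ∀ i, (fun k => ψ (bt i k)) = b i := by intro i; ext; simp [bt, ψ]
  have hb' : (fun i j => ψ (bt i j)) = b := by ext; simp [bt, ψ]
  have hx' : (fun i => ψ (xt i)) = x := by ext; simp [xt, ψ]
  have hbs : ∀ i j, (fun k => ψ ((bt i - bt j) k)) = b i - b j := by intro i j; ext; simp [bt, ψ]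
  have hx : ∀ i, ψ (xt i) = x i := by intro i; simp [xt, ψ]
  have hd : ψ Qt.det = Q.det := by rw [RingHom.map_det, RingHom.mapMatrix_apply, hQ']
  obtain ⟨k1, k2, k3, k4⟩ := poly
  refine ⟨?_, ?_, ?_, ?_⟩
  · have := congrArg ψ k1
    simpa only [map_neg, map_sub, map_add, map_mul, map_ofNat, map_pow, map_D4, map_D3, map_D2, map_D1, map_pr, hd, hx, hb, hb', hx', hbs, hQ'] using this
  · have := congrArg ψ k2
    simpa only [map_neg, map_sub, map_add, map_mul, map_ofNat, map_pow, map_D4, map_D3, map_D2, map_D1, map_pr, hd, hx, hb, hb', hx', hbs, hQ'] using this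
  · have := congrArg ψ k3
    simpa only [map_neg, map_sub, map_add, map_mul, map_ofNat, map_pow, map_D4, map_D3, map_D2, map_D1, map_pr, hd, hx, hb, hb', hx', hbs, hQ'] using this
  · have := congrArg ψ k4
    simpa only [map_neg, map_sub, map_add, map_mul, map_ofNat, map_pow, map_D4, map_D3, map_D2, map_D1, map_pr, hd, hx, hb, hb', hx', hbs, hQ'] using this

end LA
end C2


namespace C2

noncomputable def cst (σ : Type*) [Fintype σ] (k : ℕ) : σ →₀ ℕ := Finsupp.equivFunOnFinite.symm (fun _ => k)

@[simp] lemma cst_apply {σ : Type*} [Fintype σ] (k : ℕ) (i : σ) : cst σ k i = k := rfl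

lemma coeff_top_pow (p : ℕ) [Fact p.Prime] {σ : Type*} [Fintype σ]
    (P : MvPolynomial σ (ZMod p)) (hP : P.totalDegree ≤ Fintype.card σ) (s : ℕ) :
    coeff (cst σ (p^s-1)) (P^(p^s-1)) = (coeff (cst σ (p-1)) (P^(p-1)))^s := by
  classical
  have hp := (Fact.out : p.Prime)
  have hp1 := hp.one_lt
  induction s with
  | zero =>
    have : cst σ 0 = 0 := by ext; rfl
    simp [this]
  | succ s ih =>
    have hps : 1 ≤ p^s := Nat.one_le_pow _ _ hp.pos
    have e1 : p^(s+1)-1 = (p-1) + (p^s-1)*p := by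
      rw [pow_succ]
      zify [hps, hp.one_le, Nat.one_le_iff_ne_zero.2 (Nat.mul_pos hps hp.pos).ne']
      ring
    have e2 : P^(p^(s+1)-1) = P^(p-1) * expand p (P^(p^s-1)) := by
      rw [expand_zmod, ← pow_mul, ← pow_add, e1]
    rw [e2, coeff_mul, pow_succ (coeff _ _), ← ih]
    rw [Finset.sum_eq_single (cst σ (p-1), p • cst σ (p^s-1))]
    · rw [coeff_expand_smul _ hp.ne_zero, mul_comm]
    · rintro ⟨m, n⟩ hmn hne
      rw [Finset.HasAntidiagonal.mem_antidiagonal] at hmn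
      by_contra h0
      have h1 := left_ne_zero_of_mul h0
      have h2 := right_ne_zero_of_mul h0
      simp only at h1 h2 hmn
      have hdiv : ∀ i, p ∣ n i := by
        intro i
        by_contra hi
        exact h2 (coeff_expand_of_not_dvd _ hi)
      have hm : ∀ i, p - 1 ≤ m i := by
        intro i
        have := DFunLike.congr_fun hmn i
        simp only [Finsupp.add_apply, cst_apply] at this
        rw [e1] at this
        obtain ⟨k, hk⟩ := hdiv i
        have h3 : (m i + 1) % p = 0 := by
          have : m i + 1 + p * k = p * ((p^s-1)+1) := by rw [← hk]; zify [hp.one_le] at this ⊢; linarith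
          have h5 : p ∣ m i + 1 + p * k := ⟨_, this⟩
          exact Nat.mod_eq_zero_of_dvd ((Nat.dvd_add_left (dvd_mul_right _ _)).1 h5)
        have := Nat.le_of_dvd (Nat.succ_pos _) (Nat.dvd_of_mod_eq_zero h3)
        omega
      have hdeg : ∑ i, m i ≤ ∑ i : σ, (p-1) := by
        have h4 : m ∈ (P^(p-1)).support := by simpa [mem_support_iff] using h1
        have := le_totalDegree h4
        have h5 := totalDegree_pow P (p-1)
        rw [Finsupp.sum_fintype _ _ (by simp)] at this
        simp only [Finset.sum_const, Finset.card_univ, smul_eq_mul]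
        calc _ ≤ _ := this
          _ ≤ _ := h5
          _ ≤ _ := by rw [mul_comm]; gcongr
      have hmeq : ∀ i, m i = p - 1 := by
        intro i
        have := (Finset.sum_eq_sum_iff_of_le (s := Finset.univ) (f := fun _ : σ => p-1) (g := m) (fun i _ => hm i)).1
          (le_antisymm (Finset.sum_le_sum fun i _ => hm i) hdeg) i (Finset.mem_univ _)
        exact this.symm
      apply hne
      have hmm : m = cst σ (p-1) := by ext i; simp [hmeq]
      refine Prod.ext hmm ?_
      ext i
      have := DFunLike.congr_fun hmn i
      simp only [Finsupp.add_apply, cst_apply, hmeq i, e1] at this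
      simp only [Finsupp.smul_apply, cst_apply, smul_eq_mul]
      linarith
    · intro h
      exfalso; apply h
      rw [Finset.HasAntidiagonal.mem_antidiagonal]
      ext i
      simp [e1, mul_comm]

lemma sum_eval_top {K σ : Type*} [Field K] [Fintype K] [Fintype σ] [DecidableEq σ]
    (f : MvPolynomial σ K) (h : f.totalDegree ≤ (Fintype.card K - 1) * Fintype.card σ) :
    ∑ x, eval x f = (-1)^(Fintype.card σ) * coeff (cst σ (Fintype.card K - 1)) f := by
  classical
  have hq : 1 < Fintype.card K := Fintype.one_lt_card
  have hmon : ∀ d : σ →₀ ℕ, ∑ x : σ → K, ∏ i, x i ^ d i = ∏ i, ∑ a : K, a ^ d i := by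
    intro d
    rw [Finset.prod_univ_sum, Fintype.piFinset_univ]
  have h0 : ∑ x, eval x f = ∑ d ∈ f.support, f.coeff d * ∏ i, ∑ a : K, a ^ d i := by
    simp only [eval_eq']
    rw [Finset.sum_comm]
    simp only [← Finset.mul_sum, hmon]
  have hone : ∑ a : K, a ^ (Fintype.card K - 1) = -1 := by
    have : ∀ a : K, a ^ (Fintype.card K - 1) = 1 - if a = 0 then 1 else 0 := by
      intro a
      split_ifs with ha
      · subst ha; rw [zero_pow (by omega)]; simp
      · rw [FiniteField.pow_card_sub_one_eq_one a ha]; simp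
    simp [this]
  rw [h0, Finset.sum_eq_single (cst σ (Fintype.card K - 1))]
  · simp only [cst_apply, hone, Finset.prod_const, Finset.card_univ]; ring
  · intro d hd hne
    have : ∃ i, d i < Fintype.card K - 1 := by
      by_contra! hcon
      apply hne
      have h1 := (le_totalDegree hd).trans h
      rw [Finsupp.sum_fintype _ _ (by simp)] at h1
      have := (Finset.sum_eq_sum_iff_of_le (s := Finset.univ) (f := fun _ : σ => Fintype.card K-1) (g := d) (fun i _ => hcon i)).1
          (le_antisymm (Finset.sum_le_sum fun i _ => hcon i) (by simpa [mul_comm] using h1))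
      ext i
      exact (this i (Finset.mem_univ _)).symm
    obtain ⟨i, hi⟩ := this
    rw [Finset.prod_eq_zero (Finset.mem_univ i) (FiniteField.sum_pow_lt_card_sub_one K _ hi), mul_zero]
  · intro hns
    rw [notMem_support_iff.1 hns, zero_mul]

lemma card_common (p s : ℕ) [Fact p.Prime] {K σ : Type*} [Field K] [Fintype K]
    [Algebra (ZMod p) K] (hK : Fintype.card K = p^s)
    [Fintype σ] (f g : MvPolynomial σ (ZMod p))
    (hf : f.totalDegree < Fintype.card σ) (hg : g.totalDegree < Fintype.card σ)
    (hfg : f.totalDegree + g.totalDegree ≤ Fintype.card σ) :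
    ((Nat.card {x : σ → K // aeval x f = 0 ∧ aeval x g = 0} : ℕ) : ZMod p) =
      (-1)^(Fintype.card σ) * (coeff (cst σ (p-1)) ((f*g)^(p-1)))^s := by
  classical
  have : CharP K p := charP_of_injective_algebraMap (algebraMap (ZMod p) K).injective p
  apply (algebraMap (ZMod p) K).injective
  set φ := algebraMap (ZMod p) K
  have hq : 1 < Fintype.card K := Fintype.one_lt_card
  set q := Fintype.card K with hqdef
  have hev : ∀ (x : σ → K) (h : MvPolynomial σ (ZMod p)), aeval x h = eval x (map φ h) := by
    intro x h; rw [eval_map, aeval_def]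
  have hdeg : ∀ h : MvPolynomial σ (ZMod p), (map φ h).totalDegree ≤ h.totalDegree := by
    intro h
    exact Finset.sup_mono (support_map_subset _ _)
  have h1 : ((Nat.card {x : σ → K // aeval x f = 0 ∧ aeval x g = 0} : ℕ) : K) =
     ∑ x : σ → K, (1 - (eval x (map φ f))^(q-1)) * (1 - (eval x (map φ g))^(q-1)) := by
    have ha : ∀ a : K, 1 - a^(q-1) = if a = 0 then 1 else 0 := by
      intro a
      split_ifs with ha
      · subst ha; rw [zero_pow (by omega)]; simp
      · rw [hqdef, FiniteField.pow_card_sub_one_eq_one a ha]; simp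
    simp only [ha, hev, Nat.card_eq_fintype_card, Fintype.card_subtype, Finset.card_filter]
    push_cast
    refine Finset.sum_congr rfl fun x _ => ?_
    by_cases h1 : eval x (map φ f) = 0 <;> by_cases h2 : eval x (map φ g) = 0 <;> simp only [h1, h2] <;> simp
  have hz : ∀ h : MvPolynomial σ (ZMod p), h.totalDegree < Fintype.card σ → ∑ x : σ → K, (eval x (map φ h))^(q-1) = 0 := by
    intro h hh
    have := sum_eval_eq_zero ((map φ h)^(q-1)) (by
      refine (totalDegree_pow _ _).trans_lt ?_
      have := hdeg h
      rw [← hqdef]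
      have : 0 < q - 1 := by omega
      gcongr; omega)
    simpa using this
  rw [map_natCast, h1]
  have h2 : ∀ x : σ → K, (1 - (eval x (map φ f))^(q-1)) * (1 - (eval x (map φ g))^(q-1))
     = eval x (1 : MvPolynomial σ K) - (eval x (map φ f))^(q-1) - (eval x (map φ g))^(q-1) + eval x ((map φ (f*g))^(q-1)) := by
    intro x; simp; ring
  have hone : ∑ x : σ → K, eval x (1 : MvPolynomial σ K) = 0 := by
    apply sum_eval_eq_zero
    rw [totalDegree_one]
    apply Nat.mul_pos <;> omega
  simp only [h2, Finset.sum_add_distrib, Finset.sum_sub_distrib, hz f hf, hz g hg, hone]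
  rw [sum_eval_top]
  · rw [← map_pow, coeff_map, ← hqdef, hK, coeff_top_pow]
    · simp
    · exact (totalDegree_mul _ _).trans hfg
  · refine (totalDegree_pow _ _).trans ?_
    gcongr
    exact (hdeg _).trans ((totalDegree_mul _ _).trans hfg)

end C2

namespace C2
open Matrix

section PSI
variable {U E U' E' : Type*} [Fintype U] [DecidableEq U] [Fintype E] [DecidableEq E]
  [Fintype U'] [DecidableEq U'] [Fintype E'] [DecidableEq E']
  {R S : Type*} [CommRing R] [CommRing S]

def Qm (B : Matrix U E R) (x : E → R) : Matrix (E ⊕ U) (E ⊕ U) R :=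
  fromBlocks (diagonal x) Bᵀ B 0

def psi (B : Matrix U E R) (x : E → R) : R := (Qm B x).det

lemma Qm_symm (B : Matrix U E R) (x : E → R) : (Qm B x)ᵀ = Qm B x := by
  simp [Qm, fromBlocks_transpose]

lemma map_Qm (φ : R →+* S) (B : Matrix U E R) (x : E → R) :
    (Qm B x).map φ = Qm (B.map φ) (fun e => φ (x e)) := by
  rw [Qm, Qm, fromBlocks_map]
  congr 1
  · rw [diagonal_map (map_zero φ)]
  · ext; simp

lemma map_psi (φ : R →+* S) (B : Matrix U E R) (x : E → R) :
    φ (psi B x) = psi (B.map φ) (fun e => φ (x e)) := by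
  rw [psi, psi, RingHom.map_det, RingHom.mapMatrix_apply, map_Qm]

lemma psi_reindex (fU : U' ≃ U) (fE : E' ≃ E) (B : Matrix U E R) (x : E → R) :
    psi (B.submatrix fU fE) (x ∘ fE) = psi B x := by
  rw [psi, psi, ← det_submatrix_equiv_self (Equiv.sumCongr fE fU)]
  congr 1
  ext i j
  rcases i with i | i <;> rcases j with j | j <;> simp [Qm, diagonal_apply]

lemma psi_sign (B : Matrix U E R) (ε : E → R) (hε : ∀ e, ε e * ε e = 1) (x : E → R) :
    psi (B * diagonal ε) x = psi B x := by
  have h : Qm (B * diagonal ε) x = fromBlocks (diagonal ε) 0 0 1 * Qm B x * fromBlocks (diagonal ε) 0 0 1 := by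
    simp only [Qm, fromBlocks_multiply, transpose_mul, diagonal_transpose]
    congr 1
    · ext i j
      simp only [diagonal_apply, diagonal_mul_diagonal, Matrix.zero_mul, Matrix.mul_zero, add_zero, Matrix.add_apply, Matrix.zero_apply]
      split_ifs with h
      · subst h; linear_combination -(x i) * hε i
      · simp
    · simp
    · simp
    · simp
  have h2 : (fromBlocks (diagonal ε) 0 0 (1 : Matrix U U R)).det * (fromBlocks (diagonal ε) 0 0 (1 : Matrix U U R)).det = 1 := by
    simp [det_diagonal, ← Finset.prod_mul_distrib, hε]
  rw [psi, h, det_mul, det_mul, psi]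
  linear_combination (Qm B x).det * h2

lemma psi_block3 (B : Matrix (Fin 1 ⊕ U) (Fin 3 ⊕ E) R) (x : Fin 3 ⊕ E → R)
    (h1 : ∀ j i, B (Sum.inl j) (Sum.inl i) = 1) (h0 : ∀ j e, B (Sum.inl j) (Sum.inr e) = 0) :
    psi B x = D4 (Qm (B.submatrix Sum.inr Sum.inr) (x ∘ Sum.inr))
      (fun i => Sum.elim 0 (fun u => B (Sum.inr u) (Sum.inl i))) (x ∘ Sum.inl) := by
  let e : Fin 4 ⊕ (E ⊕ U) ≃ (Fin 3 ⊕ E) ⊕ (Fin 1 ⊕ U) :=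
    (Equiv.sumCongr (finSumFinEquiv (m := 3) (n := 1)).symm (Equiv.refl _)).trans (Equiv.sumSumSumComm _ _ _ _)
  have e0 : e (Sum.inl 0) = Sum.inl (Sum.inl 0) := rfl
  have e1 : e (Sum.inl 1) = Sum.inl (Sum.inl 1) := rfl
  have e2 : e (Sum.inl 2) = Sum.inl (Sum.inl 2) := rfl
  have e3 : e (Sum.inl 3) = Sum.inr (Sum.inl 0) := rfl
  have e4 : ∀ i, e (Sum.inr (Sum.inl i)) = Sum.inl (Sum.inr i) := fun _ => rfl
  have e5 : ∀ i, e (Sum.inr (Sum.inr i)) = Sum.inr (Sum.inr i) := fun _ => rfl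
  rw [psi, D4, ← det_submatrix_equiv_self e]
  congr 1
  ext i j
  rcases i with i | i | i <;> rcases j with j | j | j <;> (try fin_cases i) <;> (try fin_cases j) <;>
    simp [Qm, bm4, diagonal_apply, e0, e1, e2, e3, e4, e5, h1, h0]

lemma psi_block2 (B : Matrix (Fin 1 ⊕ U) (Fin 2 ⊕ E) R) (x : Fin 2 ⊕ E → R)
    (h1 : ∀ j i, B (Sum.inl j) (Sum.inl i) = 1) (h0 : ∀ j e, B (Sum.inl j) (Sum.inr e) = 0) :
    psi B x = D3 (Qm (B.submatrix Sum.inr Sum.inr) (x ∘ Sum.inr))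
      ![Sum.elim 0 (fun u => B (Sum.inr u) (Sum.inl 0)), Sum.elim 0 (fun u => B (Sum.inr u) (Sum.inl 1)), 0]
      ![x (Sum.inl 0), x (Sum.inl 1), 0] := by
  let e : Fin 3 ⊕ (E ⊕ U) ≃ (Fin 2 ⊕ E) ⊕ (Fin 1 ⊕ U) :=
    (Equiv.sumCongr (finSumFinEquiv (m := 2) (n := 1)).symm (Equiv.refl _)).trans (Equiv.sumSumSumComm _ _ _ _)
  have e0 : e (Sum.inl 0) = Sum.inl (Sum.inl 0) := rfl
  have e1 : e (Sum.inl 1) = Sum.inl (Sum.inl 1) := rfl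
  have e3 : e (Sum.inl 2) = Sum.inr (Sum.inl 0) := rfl
  have e4 : ∀ i, e (Sum.inr (Sum.inl i)) = Sum.inl (Sum.inr i) := fun _ => rfl
  have e5 : ∀ i, e (Sum.inr (Sum.inr i)) = Sum.inr (Sum.inr i) := fun _ => rfl
  rw [psi, D3, ← det_submatrix_equiv_self e]
  congr 1
  ext i j
  rcases i with i | i | i <;> rcases j with j | j | j <;> (try fin_cases i) <;> (try fin_cases j) <;>
    simp [Qm, bm3, diagonal_apply, e0, e1, e3, e4, e5, h1, h0]

lemma psi_block1 (B : Matrix U (Fin 1 ⊕ E) R) (x : Fin 1 ⊕ E → R) :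
    psi B x = D1 (Qm (B.submatrix id Sum.inr) (x ∘ Sum.inr))
      ![Sum.elim 0 (fun u => B u (Sum.inl 0)), 0, 0] ![x (Sum.inl 0), 0, 0] := by
  rw [psi, D1, ← det_submatrix_equiv_self (Equiv.sumAssoc (Fin 1) E U).symm]
  congr 1
  ext i j
  rcases i with i | i | i <;> rcases j with j | j | j <;> (try fin_cases i) <;> (try fin_cases j) <;>
    simp [Qm, bm1, diagonal_apply]

/-- splitting off the range of an injective family -/
noncomputable def spl {k : ℕ} {A : Type*} (t : Fin k → A) (ht : Function.Injective t) :
    Fin k ⊕ {a // ¬ ∃ i, t i = a} ≃ A := by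
  classical
  exact (Equiv.sumCongr (Equiv.ofInjective t ht) (Equiv.refl _)).trans (Equiv.sumCompl (fun a => ∃ i, t i = a))

lemma spl_inl {k : ℕ} {A : Type*} (t : Fin k → A) (ht : Function.Injective t) (i) : spl t ht (Sum.inl i) = t i := rfl
lemma spl_inr {k : ℕ} {A : Type*} (t : Fin k → A) (ht : Function.Injective t) (i) : spl t ht (Sum.inr i) = i := rfl

end PSI
end C2

namespace C2
open Matrix

section DEG
variable {σ R : Type*} [CommRing R]

def dle (D : ℤ) (f : MvPolynomial σ R) : Prop := ∀ m, coeff m f ≠ 0 → ((Finsupp.degree m : ℕ) : ℤ) ≤ D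

lemma dle_zero (D : ℤ) : dle D (0 : MvPolynomial σ R) := by
  intro m h; simp at h

lemma dle_mono {D D' : ℤ} (h : D ≤ D') {f : MvPolynomial σ R} (hf : dle D f) : dle D' f :=
  fun m hm => (hf m hm).trans h

lemma dle_C {D : ℤ} (h : 0 ≤ D) (a : R) : dle D (C a : MvPolynomial σ R) := by
  classical
  intro m hm
  rw [coeff_C] at hm
  split_ifs at hm with h0
  · subst h0; simpa using h
  · exact absurd rfl hm

lemma dle_X {D : ℤ} (h : 1 ≤ D) (i : σ) : dle D (X i : MvPolynomial σ R) := by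
  classical
  intro m hm
  rw [coeff_X] at hm
  split_ifs at hm with h0
  · subst h0; simpa using h
  · exact absurd rfl hm

lemma dle_sum {ι : Type*} (s : Finset ι) (D : ℤ) (f : ι → MvPolynomial σ R) (h : ∀ i ∈ s, dle D (f i)) :
    dle D (∑ i ∈ s, f i) := by
  intro m hm
  rw [coeff_sum] at hm
  obtain ⟨i, hi, hne⟩ := Finset.exists_ne_zero_of_sum_ne_zero hm
  exact h i hi m hne

lemma dle_mul {D D' : ℤ} {f g : MvPolynomial σ R} (hf : dle D f) (hg : dle D' g) : dle (D + D') (f * g) := by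
  classical
  intro m hm
  rw [coeff_mul] at hm
  obtain ⟨i, hi, hne⟩ := Finset.exists_ne_zero_of_sum_ne_zero hm
  rw [Finset.HasAntidiagonal.mem_antidiagonal] at hi
  have h1 := hf _ (left_ne_zero_of_mul hne)
  have h2 := hg _ (right_ne_zero_of_mul hne)
  rw [← hi, map_add]
  push_cast
  linarith

lemma dle_prod {ι : Type*} (s : Finset ι) (D : ι → ℤ) (f : ι → MvPolynomial σ R) (h : ∀ i ∈ s, dle (D i) (f i)) :
    dle (∑ i ∈ s, D i) (∏ i ∈ s, f i) := by
  classical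
  induction s using Finset.induction_on with
  | empty => simpa using dle_C (le_refl 0) (1 : R)
  | insert a s ha ih =>
    rw [Finset.sum_insert ha, Finset.prod_insert ha]
    exact dle_mul (h a (Finset.mem_insert_self _ _)) (ih fun i hi => h i (Finset.mem_insert_of_mem hi))

lemma dle_det {n : Type*} [Fintype n] [DecidableEq n] (M : Matrix n n (MvPolynomial σ R)) (r c : n → ℤ)
    (h : ∀ i j, dle (r i + c j) (M i j)) : dle (∑ i, r i + ∑ i, c i) M.det := by
  rw [det_apply]
  apply dle_sum
  intro τ _
  have h1 : dle (∑ i, r i + ∑ i, c i) (∏ i, M (τ i) i) := by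
    have := dle_prod Finset.univ (fun i => r (τ i) + c i) (fun i => M (τ i) i) (fun i _ => h _ _)
    rwa [Finset.sum_add_distrib, Equiv.sum_comp τ r] at this
  have h2 := dle_mul (dle_C (le_refl 0) ((Equiv.Perm.sign τ : ℤ) : R)) h1
  rw [zero_add] at h2
  convert h2 using 1
  rw [Units.smul_def, zsmul_eq_mul]
  simp

lemma dle_total {D : ℤ} {f : MvPolynomial σ R} (hf : dle D f) (N : ℕ) (h : D ≤ N) : f.totalDegree ≤ N := by
  refine Finset.sup_le ?_
  intro m hm
  have := hf m (mem_support_iff.1 hm)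
  have e : Finsupp.degree m = m.sum fun _ e => e := by
    rw [Finsupp.degree_apply]; rfl
  rw [e] at this
  exact_mod_cast this.trans h

end DEG

section DQ
variable {U E : Type*} [Fintype U] [DecidableEq U] [Fintype E] [DecidableEq E] {R : Type*} [CommRing R]

noncomputable def QX (B : Matrix U E R) : Matrix (E ⊕ U) (E ⊕ U) (MvPolynomial E R) := Qm (B.map C) X

lemma dle_QX (B : Matrix U E R) (i j : E ⊕ U) :
    dle (Sum.elim (fun _ => 1) (fun _ => 0) i + Sum.elim (fun _ => 0) (fun _ => -1) j) (QX B i j) := by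
  rcases i with i | i <;> rcases j with j | j
  · simp only [QX, Qm, fromBlocks_apply₁₁, diagonal_apply, Sum.elim_inl]
    split_ifs
    · exact dle_X (by norm_num) _
    · exact dle_zero _
  · simp only [QX, Qm, fromBlocks_apply₁₂, Sum.elim_inl, Sum.elim_inr]
    exact dle_C (by norm_num) _
  · simp only [QX, Qm, fromBlocks_apply₂₁, Sum.elim_inl, Sum.elim_inr]
    exact dle_C (by norm_num) _
  · simp only [QX, Qm, fromBlocks_apply₂₂, Sum.elim_inl, Sum.elim_inr]
    exact dle_zero _

lemma dle_psi (B : Matrix U E R) : dle ((Fintype.card E : ℤ) - Fintype.card U) (QX B).det := by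
  have := dle_det (QX B) _ _ (dle_QX B)
  simpa [Fintype.sum_sum_type, sub_eq_add_neg] using this

lemma dle_adj (B : Matrix U E R) (i j) : dle ((Fintype.card E : ℤ) - Fintype.card U + 1) (adjugate (QX B) i j) := by
  rw [adjugate_apply]
  have := dle_det ((QX B).updateRow j (Pi.single i 1))
    (fun k => Sum.elim (fun _ => 1) (fun _ => 0) k + if k = j then 1 else 0)
    (Sum.elim (fun _ => 0) (fun _ => -1)) (by
      intro k l
      by_cases hk : k = j
      · subst hk
        rw [updateRow_self]
        by_cases hl : l = i
        · subst hl
          rw [Pi.single_eq_same]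
          refine dle_C ?_ 1
          rcases k with k | k <;> rcases l with l | l <;> simp
        · rw [Pi.single_eq_of_ne hl]; exact dle_zero _
      · rw [updateRow_ne hk]
        refine dle_mono ?_ (dle_QX B k l)
        simp [hk])
  refine dle_mono (le_of_eq ?_) this
  rw [Finset.sum_add_distrib]
  simp [Fintype.sum_sum_type]
  ring

lemma dle_pr (B : Matrix U E R) (u w : E ⊕ U → R) :
    dle ((Fintype.card E : ℤ) - Fintype.card U + 1) (pr (QX B) (fun i => C (u i)) (fun i => C (w i))) := by
  unfold pr dotProduct mulVec dotProduct
  refine dle_sum _ _ _ fun i _ => ?_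
  have := dle_mul (dle_C (le_refl 0) (u i)) (dle_sum Finset.univ _ (fun j => adjugate (QX B) i j * C (w j))
    (fun j _ => dle_mul (dle_adj B i j) (dle_C (le_refl 0) (w j))))
  simpa using this

lemma eval_QX {S : Type*} [CommRing S] (φ : R →+* S) (B : Matrix U E R) (x : E → S) :
    (QX B).map (eval₂Hom φ x) = Qm (B.map φ) x := by
  rw [QX, map_Qm]
  congr 1
  · ext; simp
  · ext; simp

lemma eval_QX_det {S : Type*} [CommRing S] (φ : R →+* S) (B : Matrix U E R) (x : E → S) :
    eval₂Hom φ x (QX B).det = psi (B.map φ) x := by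
  rw [RingHom.map_det, RingHom.mapMatrix_apply, eval_QX, psi]

lemma eval_QX_pr {S : Type*} [CommRing S] (φ : R →+* S) (B : Matrix U E R) (u w : E ⊕ U → R) (x : E → S) :
    eval₂Hom φ x (pr (QX B) (fun i => C (u i)) (fun i => C (w i))) =
      pr (Qm (B.map φ) x) (fun i => φ (u i)) (fun i => φ (w i)) := by
  rw [map_pr, eval_QX]
  simp

lemma cw (p : ℕ) {F : Type*} [Field F] [Fintype F] [CharP F p] [Nonempty U] [Nonempty E] (B : Matrix U E F) :
    p ∣ Nat.card {x : E → F // psi B x = 0} := by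
  classical
  have hE : 0 < Fintype.card E := Fintype.card_pos
  have hU : 0 < Fintype.card U := Fintype.card_pos
  have h := dle_total (dle_psi B) (Fintype.card E - 1) (by omega)
  have := char_dvd_card_solutions p (f := (QX B).det) (by omega)
  rw [← Nat.card_eq_fintype_card] at this
  have e : ∀ x, eval x (QX B).det = psi B x := by
    intro x
    have := eval_QX_det (RingHom.id F) B x
    simpa using this
  simpa [e] using this

end DQ
end C2

namespace C2
open Matrix

section CNT
variable {U E U' E' : Type*} [Fintype U] [DecidableEq U] [Fintype E] [DecidableEq E]
  [Fintype U'] [DecidableEq U'] [Fintype E'] [DecidableEq E']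
  {F : Type*} [Field F] [Fintype F]

lemma card_psi_reindex (fU : U' ≃ U) (fE : E' ≃ E) (B : Matrix U E F) :
    Nat.card {x // psi (B.submatrix fU fE) x = 0} = Nat.card {x // psi B x = 0} := by
  refine (Nat.card_congr (Equiv.subtypeEquiv (fE.symm.arrowCongr (Equiv.refl F)) ?_)).symm
  intro x
  rw [← psi_reindex fU fE B x]
  rfl

open Classical in
lemma card_fibre (p : ℕ) (hpq : p ∣ Fintype.card F) (d P R m T : F) (h : d * T = P * R - m^2) :
    ∃ k : ℕ, Nat.card {x : F×F×F // d*(x.2.1*x.2.2 + x.2.1*x.1 + x.2.2*x.1) - x.2.1*R - x.2.2*P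
      - x.1*(P+R-2*m) + T = 0} = Fintype.card F^2 * k ∧
      (k : ZMod p) = 1 - ((if d = 0 ∧ P = 0 ∧ R = 0 ∧ m = 0 then 1 else 0 : ℕ) : ZMod p) := by
  by_cases hz : d = 0 ∧ P = 0 ∧ R = 0 ∧ m = 0
  · obtain ⟨rfl, rfl, rfl, rfl⟩ := hz
    by_cases hT : T = 0
    · refine ⟨Fintype.card F, ?_, ?_⟩
      · simp [hT]
        ring
      · simp [(ZMod.natCast_eq_zero_iff _ _).2 hpq]
    · refine ⟨0, ?_, ?_⟩
      · simp [hT]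
      · simp
  · refine ⟨1, ?_, ?_⟩
    · rw [card_quad d P R m T h, mul_one]
      by_contra hc
      exact hz (by tauto)
    · simp [hz]

def g3 : (F×F×F)×(E → F) ≃ (Fin 3 ⊕ E → F) where
  toFun y := Sum.elim ![y.1.2.1, y.1.2.2, y.1.1] y.2
  invFun f := ((f (Sum.inl 2), f (Sum.inl 0), f (Sum.inl 1)), f ∘ Sum.inr)
  left_inv y := by rcases y with ⟨⟨a, b, c⟩, y⟩; rfl
  right_inv f := by
    ext i
    rcases i with i | i
    · fin_cases i <;> rfl
    · rfl

lemma count3 (p : ℕ) (hpq : p ∣ Fintype.card F) (B : Matrix (Fin 1 ⊕ U) (Fin 3 ⊕ E) F)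
    (h1 : ∀ j i, B (Sum.inl j) (Sum.inl i) = 1) (h0 : ∀ j e, B (Sum.inl j) (Sum.inr e) = 0)
    (B' : Matrix U E F) (hB' : B' = B.submatrix Sum.inr Sum.inr) (b : Fin 3 → E ⊕ U → F)
    (hb : b = fun i => Sum.elim (0 : E → F) (fun u => B (Sum.inr u) (Sum.inl i))) :
    ∃ k : ℕ, Nat.card {x // psi B x = 0} = Fintype.card F^2 * k ∧
      (k : ZMod p) = (Fintype.card (E → F) : ZMod p) -
        (Nat.card {x : E → F // psi B' x = 0 ∧ pr (Qm B' x) (b 0 - b 2) (b 0 - b 2) = 0 ∧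
          pr (Qm B' x) (b 1 - b 2) (b 1 - b 2) = 0 ∧ pr (Qm B' x) (b 0 - b 2) (b 1 - b 2) = 0} : ZMod p) := by
  classical
  have hI : ∀ (x : E → F) (y : Fin 3 → F), Idents (Qm B' x) b y := fun x y => idents _ (Qm_symm _ _) _ _
  have hps : ∀ (y : F×F×F) (x : E → F), psi B (g3 (y, x)) = 0 ↔
      psi B' x*(y.2.1*y.2.2 + y.2.1*y.1 + y.2.2*y.1) - y.2.1* pr (Qm B' x) (b 1 - b 2) (b 1 - b 2)
        - y.2.2*pr (Qm B' x) (b 0 - b 2) (b 0 - b 2)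
      - y.1*(pr (Qm B' x) (b 0 - b 2) (b 0 - b 2)+pr (Qm B' x) (b 1 - b 2) (b 1 - b 2)
        -2*pr (Qm B' x) (b 0 - b 2) (b 1 - b 2)) + D2 (Qm B' x) b = 0 := by
    intro y x
    rw [psi_block3 B _ h1 h0, ← hb, ← hB']
    have := (hI x (g3 (y, x) ∘ Sum.inl)).1
    have e : (g3 (y, x) : Fin 3 ⊕ E → F) ∘ Sum.inr = x := rfl
    rw [e, this, neg_eq_zero]
    rfl
  have hcard : Nat.card {x // psi B x = 0} = ∑ x : E → F, Nat.card {y : F×F×F // psi B (g3 (y, x)) = 0} := by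
    rw [← card_fib]
    exact (Nat.card_congr (Equiv.subtypeEquiv g3 (fun _ => Iff.rfl))).symm
  have hk : ∀ x : E → F, ∃ k : ℕ, Nat.card {y : F×F×F // psi B (g3 (y, x)) = 0} = Fintype.card F^2 * k ∧
      (k : ZMod p) = 1 - ((if psi B' x = 0 ∧ pr (Qm B' x) (b 0 - b 2) (b 0 - b 2) = 0 ∧
          pr (Qm B' x) (b 1 - b 2) (b 1 - b 2) = 0 ∧ pr (Qm B' x) (b 0 - b 2) (b 1 - b 2) = 0 then 1 else 0 : ℕ) : ZMod p) := by
    intro x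
    simp only [hps]
    exact card_fibre p hpq _ _ _ _ _ ((hI x 0).2.1)
  choose k hk1 hk2 using hk
  refine ⟨∑ x, k x, ?_, ?_⟩
  · rw [hcard, Finset.mul_sum]
    exact Finset.sum_congr rfl fun x _ => hk1 x
  · push_cast
    rw [Finset.sum_congr rfl fun x _ => hk2 x, Finset.sum_sub_distrib, ← Nat.cast_sum, Finset.sum_boole]
    rw [Nat.card_eq_fintype_card, Fintype.card_subtype]
    simp

def g2 : F×F×(E → F) ≃ (Fin 2 ⊕ E → F) where
  toFun y := Sum.elim ![y.2.1 - y.1, y.1] y.2.2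
  invFun f := (f (Sum.inl 1), f (Sum.inl 0) + f (Sum.inl 1), f ∘ Sum.inr)
  left_inv y := by rcases y with ⟨a, b, y⟩; simp
  right_inv f := by
    ext i
    rcases i with i | i
    · fin_cases i <;> simp
    · rfl

def g1 : F×(E → F) ≃ (Fin 1 ⊕ E → F) where
  toFun y := Sum.elim ![y.1] y.2
  invFun f := (f (Sum.inl 0), f ∘ Sum.inr)
  left_inv y := by rcases y with ⟨a, y⟩; rfl
  right_inv f := by
    ext i
    rcases i with i | i
    · fin_cases i; rfl
    · rfl

lemma psi_g1 (B : Matrix U (Fin 1 ⊕ E) F) (B' : Matrix U E F) (hB' : B' = B.submatrix id Sum.inr)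
    (b : E ⊕ U → F) (hb : b = Sum.elim (0 : E → F) (fun u => B u (Sum.inl 0))) (z : F) (x : E → F) :
    psi B (g1 (z, x)) = z * psi B' x - pr (Qm B' x) b b := by
  rw [psi_block1, ← hb, ← hB']
  have e : (g1 (z, x) : Fin 1 ⊕ E → F) ∘ Sum.inr = x := rfl
  rw [e, (idents _ (Qm_symm B' x) ![b, 0, 0] _).2.2.2]
  rfl

lemma count1 (B : Matrix U (Fin 1 ⊕ E) F) (B' : Matrix U E F) (hB' : B' = B.submatrix id Sum.inr)
    (b : E ⊕ U → F) (hb : b = Sum.elim (0 : E → F) (fun u => B u (Sum.inl 0))) :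
    Nat.card {x // psi B x = 0} + Nat.card {x // psi B' x = 0} =
      Fintype.card F * Nat.card {x // psi B' x = 0 ∧ pr (Qm B' x) b b = 0} + Fintype.card (E → F) := by
  classical
  have h := card_lin (fun x => psi B' x) (fun x => - pr (Qm B' x) b b)
  simp only [neg_eq_zero] at h
  rw [← h]
  congr 1
  refine (Nat.card_congr (Equiv.subtypeEquiv g1 ?_)).symm
  rintro ⟨z, x⟩
  rw [psi_g1 B B' hB' b hb, sub_eq_add_neg]

lemma count2 (p : ℕ) [CharP F p] [Nonempty U] (B : Matrix (Fin 1 ⊕ U) (Fin 2 ⊕ E) F)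
    (h1 : ∀ j i, B (Sum.inl j) (Sum.inl i) = 1) (h0 : ∀ j e, B (Sum.inl j) (Sum.inr e) = 0) :
    p * Fintype.card F ∣ Nat.card {x // psi B x = 0} := by
  classical
  let B' : Matrix U E F := B.submatrix Sum.inr Sum.inr
  let B3 : Matrix U (Fin 1 ⊕ E) F := Matrix.of fun u => Sum.elim
    (fun _ => B (Sum.inr u) (Sum.inl 0) - B (Sum.inr u) (Sum.inl 1)) (fun e => B (Sum.inr u) (Sum.inr e))
  have key : ∀ (a z : F) (x : E → F), psi B (g2 (a, z, x)) = - psi B3 (g1 (z, x)) := by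
    intro a z x
    rw [psi_block2 B _ h1 h0, psi_g1 B3 B' rfl _ rfl]
    have e : (g2 (a, z, x) : Fin 2 ⊕ E → F) ∘ Sum.inr = x := rfl
    rw [e, (idents _ (Qm_symm B' x) _ _).2.2.1]
    have eb : (Sum.elim (0 : E → F) (fun u => B (Sum.inr u) (Sum.inl 0)) - Sum.elim (0 : E → F) (fun u => B (Sum.inr u) (Sum.inl 1)) : E ⊕ U → F)
      = Sum.elim (0 : E → F) fun u => B3 u (Sum.inl 0) := by
      ext i; rcases i with i | i <;> simp [B3]
    have ez : (g2 (a, z, x) : Fin 2 ⊕ E → F) (Sum.inl 0) + (g2 (a, z, x) : Fin 2 ⊕ E → F) (Sum.inl 1) = z := by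
      simp [g2]
    simp only [Matrix.cons_val_zero, Matrix.cons_val_one, ez, eb]
    rfl
  have hc : Nat.card {x // psi B x = 0} = Fintype.card F * Nat.card {x // psi B3 x = 0} := by
    rw [← Nat.card_eq_fintype_card, ← Nat.card_prod]
    refine Nat.card_congr ?_
    refine (Equiv.subtypeEquiv g2.symm (q := fun y => psi B3 (g1 y.2) = 0) ?_).trans ?_
    · intro x
      obtain ⟨⟨a, z, y⟩, rfl⟩ := g2.surjective x
      rw [key, neg_eq_zero, Equiv.symm_apply_apply]
    · exact
      { toFun := fun y => (y.1.1, ⟨g1 y.1.2, y.2⟩)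
        invFun := fun y => ⟨(y.1, g1.symm y.2.1), by simpa using y.2.2⟩
        left_inv := fun y => by simp
        right_inv := fun y => by simp }
  rw [hc, mul_comm p]
  exact mul_dvd_mul_left _ (cw p B3)

end CNT
end C2

namespace C2
open Matrix

section NRM
variable {U E : Type*} [Fintype U] [DecidableEq U] [Fintype E] [DecidableEq E]
  {R : Type*} [CommRing R] {F : Type*} [Field F] [Fintype F]

lemma inj1 (u0 : U) : Function.Injective (fun _ : Fin 1 => u0) := fun _ _ _ => Subsingleton.elim _ _

noncomputable def nrm {k : ℕ} (B : Matrix U E R) (u0 : U) (t : Fin k → E) (ht : Function.Injective t) :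
    Matrix (Fin 1 ⊕ {u : U // ¬ ∃ i : Fin 1, u0 = u}) (Fin k ⊕ {e : E // ¬ ∃ i, t i = e}) R :=
  Matrix.of fun u e => B (spl (fun _ : Fin 1 => u0) (inj1 u0) u) (spl t ht e) *
    Sum.elim (fun i => B u0 (t i)) (fun _ => 1) e

def RowAt {U E : Type*} (k : ℕ) (B : Matrix U E R) (u0 : U) (t : Fin k → E) : Prop :=
  Function.Injective t ∧ (∀ i, B u0 (t i) * B u0 (t i) = 1) ∧ ∀ e, (¬ ∃ i, t i = e) → B u0 e = 0

lemma nrm_one {k : ℕ} (B : Matrix U E R) (u0 : U) (t : Fin k → E) (h : RowAt k B u0 t) (j i) :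
    nrm B u0 t h.1 (Sum.inl j) (Sum.inl i) = 1 := by
  have := h.2.1 i
  simpa [nrm, spl_inl] using this

lemma nrm_zero {k : ℕ} (B : Matrix U E R) (u0 : U) (t : Fin k → E) (h : RowAt k B u0 t) (j e) :
    nrm B u0 t h.1 (Sum.inl j) (Sum.inr e) = 0 := by
  have := h.2.2 e e.2
  simpa [nrm, spl_inl, spl_inr] using this

open Classical in
lemma card_nrm {k : ℕ} (B : Matrix U E F) (u0 : U) (t : Fin k → E) (h : RowAt k B u0 t) :
    Nat.card {x // psi (nrm B u0 t h.1) x = 0} = Nat.card {x // psi B x = 0} := by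
  let ε : E → F := fun e => Sum.elim (fun i => B u0 (t i)) (fun _ => 1) ((spl t h.1).symm e)
  have hε : ∀ e, ε e * ε e = 1 := by
    intro e
    simp only [ε]
    rcases (spl t h.1).symm e with i | i
    · exact h.2.1 i
    · simp
  have e1 : nrm B u0 t h.1 = (B * diagonal ε).submatrix (spl (fun _ : Fin 1 => u0) (inj1 u0)) (spl t h.1) := by
    ext u e
    simp [nrm, ε, mul_diagonal]
  rw [e1, card_psi_reindex]
  simp only [psi_sign B ε hε]

lemma pq3 (p : ℕ) (hpq : p ∣ Fintype.card F) (B : Matrix U E F) (u0 : U) (t : Fin 3 → E) (h : RowAt 3 B u0 t) :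
    p * Fintype.card F ∣ Nat.card {x // psi B x = 0} := by
  classical
  obtain ⟨k, hk, -⟩ := count3 p hpq (nrm B u0 t h.1) (nrm_one B u0 t h) (nrm_zero B u0 t h) _ rfl _ rfl
  rw [← card_nrm B u0 t h, hk, sq, mul_assoc]
  exact mul_dvd_mul hpq (Dvd.intro _ rfl)

lemma pq2 (p : ℕ) [CharP F p] (B : Matrix U E F) (u0 u1 : U) (h01 : u0 ≠ u1) (t : Fin 2 → E) (h : RowAt 2 B u0 t) :
    p * Fintype.card F ∣ Nat.card {x // psi B x = 0} := by
  classical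
  have : Nonempty {u : U // ¬ ∃ i : Fin 1, u0 = u} := ⟨⟨u1, by simpa using h01⟩⟩
  rw [← card_nrm B u0 t h]
  exact count2 p (nrm B u0 t h.1) (nrm_one B u0 t h) (nrm_zero B u0 t h)

def Row23 {U E : Type*} (B : Matrix U E R) (u0 : U) : Prop := (∃ t, RowAt 2 B u0 t) ∨ ∃ t, RowAt 3 B u0 t

lemma pq (p : ℕ) [CharP F p] (hpq : p ∣ Fintype.card F) (B : Matrix U E F) (u0 u1 : U) (h01 : u0 ≠ u1)
    (h : Row23 B u0) : p * Fintype.card F ∣ Nat.card {x // psi B x = 0} := by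
  rcases h with ⟨t, h⟩ | ⟨t, h⟩
  · exact pq2 p B u0 u1 h01 t h
  · exact pq3 p hpq B u0 t h

lemma RowAt.ext {U E : Type*} {k : ℕ} {B : Matrix U (Fin 1 ⊕ E) R} {u0 : U} {t : Fin k → E}
    (h : RowAt k (B.submatrix id Sum.inr) u0 t) (h0 : B u0 (Sum.inl 0) = 0) : RowAt k B u0 (Sum.inr ∘ t) := by
  refine ⟨Sum.inr_injective.comp h.1, h.2.1, ?_⟩
  rintro (i | e) he
  · fin_cases i; exact h0
  · exact h.2.2 e (fun ⟨i, hi⟩ => he ⟨i, by simp [hi]⟩)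

lemma Row23.ext {U E : Type*} {B : Matrix U (Fin 1 ⊕ E) R} {u0 : U}
    (h : Row23 (B.submatrix id Sum.inr) u0) (h0 : B u0 (Sum.inl 0) = 0) : Row23 B u0 := by
  rcases h with ⟨t, h⟩ | ⟨t, h⟩
  · exact Or.inl ⟨_, h.ext h0⟩
  · exact Or.inr ⟨_, h.ext h0⟩

lemma Row23.map {U E : Type*} {S : Type*} [CommRing S] (φ : R →+* S) {B : Matrix U E R} {u0 : U}
    (h : Row23 B u0) : Row23 (B.map φ) u0 := by
  have key : ∀ k (t : Fin k → E), RowAt k B u0 t → RowAt k (B.map φ) u0 t := by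
    intro k t h
    refine ⟨h.1, fun i => ?_, fun e he => ?_⟩
    · rw [map_apply, ← map_mul, h.2.1, map_one]
    · rw [map_apply, h.2.2 e he, map_zero]
  rcases h with ⟨t, h⟩ | ⟨t, h⟩
  · exact Or.inl ⟨_, key _ _ h⟩
  · exact Or.inr ⟨_, key _ _ h⟩

lemma card_Z {X : Type*} [Fintype X] (d P R m : X → F) (h : ∀ x, d x = 0 → P x * R x = m x ^ 2) :
    Nat.card {x // d x = 0 ∧ P x = 0 ∧ R x = 0 ∧ m x = 0} + Nat.card {x // d x = 0 ∧ m x = 0} =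
      Nat.card {x // d x = 0 ∧ P x = 0} + Nat.card {x // d x = 0 ∧ R x = 0} := by
  classical
  simp only [Nat.card_eq_fintype_card, Fintype.card_subtype, Finset.card_filter, ← Finset.sum_add_distrib]
  refine Finset.sum_congr rfl fun x _ => ?_
  by_cases hd : d x = 0
  · have := h x hd
    by_cases hP : P x = 0
    · have hm : m x = 0 := by
        rw [hP, zero_mul] at this
        exact pow_eq_zero_iff (two_ne_zero) |>.1 this.symm
      by_cases hR : R x = 0 <;> simp [hd, hP, hm, hR]
    · by_cases hR : R x = 0
      · have hm : m x = 0 := by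
          rw [hR, mul_zero] at this
          exact pow_eq_zero_iff (two_ne_zero) |>.1 this.symm
        simp [hd, hP, hm, hR]
      · have hm : m x ≠ 0 := by
          intro hm
          rw [hm] at this
          simp at this
          tauto
        simp [hd, hP, hm, hR]
  · simp [hd]

lemma dvd_dP (p : ℕ) [CharP F p] (hpq : p ∣ Fintype.card F) (B' : Matrix U E F) (c : U → F)
    (b b1 : U) (hb1 : b ≠ b1) (hrow : Row23 B' b) (hcb : c b = 0) (hN : 2 ≤ Fintype.card E) :
    p ∣ Nat.card {x // psi B' x = 0 ∧ pr (Qm B' x) (Sum.elim (0 : E → F) c) (Sum.elim (0 : E → F) c) = 0} := by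
  let B2 : Matrix U (Fin 1 ⊕ E) F := Matrix.of fun u => Sum.elim (fun _ => c u) (B' u)
  have h := count1 B2 B' rfl (Sum.elim (0 : E → F) c) rfl
  have h1 := pq p hpq B' b b1 hb1 hrow
  have h2 := pq p hpq B2 b b1 hb1 (Row23.ext (B := B2) hrow hcb)
  have h3 : p * Fintype.card F ∣ Fintype.card (E → F) := by
    rw [Fintype.card_fun]
    refine dvd_trans (mul_dvd_mul_right hpq _) ?_
    rw [← sq]
    exact pow_dvd_pow _ hN
  have h4 := (Nat.dvd_add_iff_left h3).2 (h ▸ dvd_add h2 h1)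
  rw [mul_comm p] at h4
  exact Nat.dvd_of_mul_dvd_mul_left Fintype.card_pos h4

end NRM
end C2

namespace C2
open Matrix

section MAIN
variable {U E : Type*} [Fintype U] [DecidableEq U] [Fintype E] [DecidableEq E]

/-- the normal form version -/
theorem main_nf (p : ℕ) [Fact p.Prime] (B : Matrix (Fin 1 ⊕ U) (Fin 3 ⊕ E) ℤ)
    (h1 : ∀ j i, B (Sum.inl j) (Sum.inl i) = 1) (h0 : ∀ j e, B (Sum.inl j) (Sum.inr e) = 0)
    (a b : U) (hab : a ≠ b)
    (hb0 : B (Sum.inr b) (Sum.inl 0) = 0) (hb2 : B (Sum.inr b) (Sum.inl 2) = 0)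
    (ha1 : B (Sum.inr a) (Sum.inl 1) = 0) (ha2 : B (Sum.inr a) (Sum.inl 2) = 0)
    (hra : Row23 (B.submatrix Sum.inr Sum.inr) a) (hrb : Row23 (B.submatrix Sum.inr Sum.inr) b)
    (hE : Fintype.card E + 1 = 2 * Fintype.card U) (hU : 2 ≤ Fintype.card U) :
    ∃ c₁ c : ZMod p, ∀ (s : ℕ) (_ : 1 ≤ s) (K : Type) [Field K] [Fintype K] [Algebra (ZMod p) K]
      (_ : Fintype.card K = p ^ s),
      ∃ k : ℕ, Nat.card {x // psi (B.map (Int.castRingHom K)) x = 0} = (p ^ s) ^ 2 * k ∧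
        (k : ZMod p) = c₁ * c ^ s := by
  let Bz : Matrix U E (ZMod p) := (B.submatrix Sum.inr Sum.inr).map (Int.castRingHom (ZMod p))
  let bi : Fin 3 → E ⊕ U → ℤ := fun i => Sum.elim (0 : E → ℤ) (fun u => B (Sum.inr u) (Sum.inl i))
  let f : MvPolynomial E (ZMod p) := (QX Bz).det
  let g : MvPolynomial E (ZMod p) := pr (QX Bz) (fun i => C (((bi 0 - bi 2) i : ℤ) : ZMod p))
    (fun i => C (((bi 1 - bi 2) i : ℤ) : ZMod p))
  refine ⟨(-1) ^ Fintype.card E, coeff (cst E (p-1)) ((f*g)^(p-1)), ?_⟩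
  intro s hs K _ _ _ hK
  have hp := (Fact.out : p.Prime)
  have : CharP K p := charP_of_injective_algebraMap (algebraMap (ZMod p) K).injective p
  have hpq : p ∣ Fintype.card K := by rw [hK]; exact dvd_pow_self p (by omega)
  let BK : Matrix (Fin 1 ⊕ U) (Fin 3 ⊕ E) K := B.map (Int.castRingHom K)
  let B' : Matrix U E K := BK.submatrix Sum.inr Sum.inr
  let bK : Fin 3 → E ⊕ U → K := fun i => Sum.elim (0 : E → K) (fun u => BK (Sum.inr u) (Sum.inl i))
  obtain ⟨k, hk1, hk2⟩ := count3 p hpq BK (by intro j i; simp [BK, h1]) (by intro j e; simp [BK, h0])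
    B' rfl bK rfl
  refine ⟨k, by rw [← hK]; exact hk1, ?_⟩
  have hZ := card_Z (fun x => psi B' x) (fun x => pr (Qm B' x) (bK 0 - bK 2) (bK 0 - bK 2))
    (fun x => pr (Qm B' x) (bK 1 - bK 2) (bK 1 - bK 2)) (fun x => pr (Qm B' x) (bK 0 - bK 2) (bK 1 - bK 2))
    (by
      intro x hx
      have := (idents _ (Qm_symm B' x) bK 0).2.1
      change psi B' x * _ = _ at this
      rw [show psi B' x = 0 from hx, zero_mul] at this
      linear_combination -this)
  have hbs : ∀ i j, bK i - bK j = Sum.elim (0 : E → K)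
      (fun u => BK (Sum.inr u) (Sum.inl i) - BK (Sum.inr u) (Sum.inl j)) := by
    intro i j
    ext l
    rcases l with l | l <;> simp [bK]
  have hP : p ∣ Nat.card {x // psi B' x = 0 ∧ pr (Qm B' x) (bK 0 - bK 2) (bK 0 - bK 2) = 0} := by
    rw [hbs]
    exact dvd_dP p hpq B' _ b a hab.symm (hrb.map (Int.castRingHom K)) (by simp [BK, hb0, hb2]) (by omega)
  have hR : p ∣ Nat.card {x // psi B' x = 0 ∧ pr (Qm B' x) (bK 1 - bK 2) (bK 1 - bK 2) = 0} := by
    rw [hbs]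
    exact dvd_dP p hpq B' _ a b hab (hra.map (Int.castRingHom K)) (by simp [BK, ha1, ha2]) (by omega)
  have hZ' := congrArg (Nat.cast : ℕ → ZMod p) hZ
  push_cast at hZ'
  rw [(ZMod.natCast_eq_zero_iff _ _).2 hP, (ZMod.natCast_eq_zero_iff _ _).2 hR, add_zero] at hZ'
  have hc0 : ((Fintype.card (E → K) : ℕ) : ZMod p) = 0 := by
    rw [ZMod.natCast_eq_zero_iff, Fintype.card_fun]
    exact dvd_pow hpq (by omega)
  have hf : ∀ x : E → K, aeval x f = psi B' x := by
    intro x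
    have := eval_QX_det (algebraMap (ZMod p) K) Bz x
    have e : Bz.map (algebraMap (ZMod p) K) = B' := by ext; simp [Bz, B', BK]
    rw [e] at this
    exact this
  have hg : ∀ x : E → K, aeval x g = pr (Qm B' x) (bK 0 - bK 2) (bK 1 - bK 2) := by
    intro x
    have := eval_QX_pr (algebraMap (ZMod p) K) Bz (fun i => (((bi 0 - bi 2) i : ℤ) : ZMod p))
      (fun i => (((bi 1 - bi 2) i : ℤ) : ZMod p)) x
    have e : Bz.map (algebraMap (ZMod p) K) = B' := by ext; simp [Bz, B', BK]
    have e2 : ∀ i j, (fun l => algebraMap (ZMod p) K (((bi i - bi j) l : ℤ) : ZMod p)) = bK i - bK j := by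
      intro i j
      ext l
      rcases l with l | l <;> simp [bi, bK, BK]
    rw [e, e2, e2] at this
    exact this
  have hdf := dle_psi Bz
  have hdg := dle_pr Bz (fun i => (((bi 0 - bi 2) i : ℤ) : ZMod p)) (fun i => (((bi 1 - bi 2) i : ℤ) : ZMod p))
  have hdf' : f.totalDegree ≤ Fintype.card U - 1 := dle_total hdf _ (by omega)
  have hdg' : g.totalDegree ≤ Fintype.card U := dle_total hdg _ (by omega)
  have hcc := card_common p s (K := K) hK f g (by omega) (by omega) (by omega)
  simp only [hf, hg] at hcc
  rw [hk2, hc0, ← hcc]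
  linear_combination -hZ'

theorem main_la (p : ℕ) [Fact p.Prime] (B : Matrix U E ℤ) (u0 : U) (t : Fin 3 → E) (h : RowAt 3 B u0 t)
    (a b : U) (hab : a ≠ b) (ha : u0 ≠ a) (hb : u0 ≠ b)
    (hb0 : B b (t 0) = 0) (hb2 : B b (t 2) = 0) (ha1 : B a (t 1) = 0) (ha2 : B a (t 2) = 0)
    (hra : Row23 (B.submatrix id (Subtype.val : {e : E // ¬ ∃ i, t i = e} → E)) a)
    (hrb : Row23 (B.submatrix id (Subtype.val : {e : E // ¬ ∃ i, t i = e} → E)) b)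
    (hE : Fintype.card E = 2 * Fintype.card U) (hU : 3 ≤ Fintype.card U) :
    ∃ c₁ c : ZMod p, ∀ (s : ℕ) (_ : 1 ≤ s) (K : Type) [Field K] [Fintype K] [Algebra (ZMod p) K]
      (_ : Fintype.card K = p ^ s),
      ∃ k : ℕ, Nat.card {x // psi (B.map (Int.castRingHom K)) x = 0} = (p ^ s) ^ 2 * k ∧
        (k : ZMod p) = c₁ * c ^ s := by
  classical
  have cE := Fintype.card_congr (spl t h.1)
  have cU := Fintype.card_congr (spl (fun _ : Fin 1 => u0) (inj1 u0))
  rw [Fintype.card_sum, Fintype.card_fin] at cE cU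
  have hsub : (nrm B u0 t h.1).submatrix Sum.inr Sum.inr = B.submatrix Subtype.val Subtype.val := by
    ext i j; simp [nrm, spl_inr]
  have hrow : ∀ (a : U) (ha : ¬ ∃ i : Fin 1, u0 = a),
      Row23 (B.submatrix id (Subtype.val : {e : E // ¬ ∃ i, t i = e} → E)) a →
      Row23 ((nrm B u0 t h.1).submatrix Sum.inr Sum.inr) ⟨a, ha⟩ := by
    intro a ha hr
    rw [hsub]
    exact hr
  have ha' : ¬ ∃ i : Fin 1, u0 = a := by simpa using ha
  have hb' : ¬ ∃ i : Fin 1, u0 = b := by simpa using hb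
  obtain ⟨c₁, c, hc⟩ := main_nf p (nrm B u0 t h.1) (nrm_one B u0 t h) (nrm_zero B u0 t h) ⟨a, ha'⟩ ⟨b, hb'⟩
    (by simpa using hab) (by simp [nrm, spl_inr, spl_inl, hb0]) (by simp [nrm, spl_inr, spl_inl, hb2])
    (by simp [nrm, spl_inr, spl_inl, ha1]) (by simp [nrm, spl_inr, spl_inl, ha2])
    (hrow a ha' hra) (hrow b hb' hrb) (by omega) (by omega)
  refine ⟨c₁, c, ?_⟩
  intro s hs K _ _ _ hK
  obtain ⟨k, hk1, hk2⟩ := hc s hs K hK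
  refine ⟨k, ?_, hk2⟩
  rw [← hk1]
  have hK' : RowAt 3 (B.map (Int.castRingHom K)) u0 t :=
    ⟨h.1, fun i => by simpa using congrArg (Int.cast : ℤ → K) (h.2.1 i), fun e he => by simp [h.2.2 e he]⟩
  have e : (nrm B u0 t h.1).map (Int.castRingHom K) = nrm (B.map (Int.castRingHom K)) u0 t hK'.1 := by
    ext i j
    rcases j with j | j <;> simp [nrm]
  rw [e, ← card_nrm _ u0 t hK']

end MAIN
end C2

namespace C2
open Matrix

section EXPAND
variable {U E : Type*} [Fintype U] [DecidableEq U] [Fintype E] [DecidableEq E]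
  {R : Type*} [CommRing R]

def zb {T : Type*} (A : Matrix U T R) : Matrix (T ⊕ U) (T ⊕ U) R := fromBlocks 0 Aᵀ A 0

def NS (B : Matrix U E R) (S : Finset E) : Matrix (E ⊕ U) (E ⊕ U) R :=
  fromBlocks (diagonal fun e => if e ∈ S then 1 else 0) (Matrix.of fun e u => if e ∈ S then 0 else B u e) B 0

lemma det_NS (B : Matrix U E R) (S : Finset E) :
    (NS B S).det = (zb (B.submatrix id (Subtype.val : {e // e ∉ S} → E))).det := by
  let e : {e // e ∈ S} ⊕ ({e // e ∉ S} ⊕ U) ≃ E ⊕ U :=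
    (Equiv.sumAssoc _ _ _).symm.trans (Equiv.sumCongr (Equiv.sumCompl (fun e => e ∈ S)) (Equiv.refl U))
  have e1 : ∀ i, e (Sum.inl i) = Sum.inl i.1 := fun _ => rfl
  have e2 : ∀ i, e (Sum.inr (Sum.inl i)) = Sum.inl i.1 := fun _ => rfl
  have e3 : ∀ i, e (Sum.inr (Sum.inr i)) = Sum.inr i := fun _ => rfl
  have key : (NS B S).submatrix e e = fromBlocks 1 0
      (Matrix.of fun i j => NS B S (e (Sum.inr i)) (e (Sum.inl j)))
      (zb (B.submatrix id (Subtype.val : {e // e ∉ S} → E))) := by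
    ext i j
    rcases i with i | i | i <;> rcases j with j | j | j
    · simp only [submatrix_apply, e1, NS, fromBlocks_apply₁₁, diagonal_apply, one_apply, i.2, if_true]
      by_cases h : i = j
      · subst h; simp
      · rw [if_neg h, if_neg (fun h' => h (Subtype.ext h'))]
    · have : i.1 ≠ j.1 := fun h => j.2 (h ▸ i.2)
      simp [NS, e1, e2, this]
    · simp [NS, e1, e3]
    · simp [e1, e2]
    · have := i.2
      simp [NS, zb, e2, diagonal_apply, this]
    · simp [NS, zb, e2, e3, i.2]
    · simp [e1, e2]
    · simp [NS, zb, e2, e3]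
    · simp [NS, zb, e3]
  rw [← det_submatrix_equiv_self e, key, det_fromBlocks_zero₁₂, det_one, one_mul]

lemma psi_expand (B : Matrix U E R) (x : E → R) :
    psi B x = ∑ S : Finset E, (∏ e ∈ S, x e) * (zb (B.submatrix id (Subtype.val : {e // e ∉ S} → E))).det := by
  classical
  let f : MultilinearMap R (fun _ : E ⊕ U => (E ⊕ U → R)) R := (detRowAlternating (n := E ⊕ U) (R := R)).toMultilinearMap
  have hf : ∀ M : Matrix (E ⊕ U) (E ⊕ U) R, f M = M.det := fun _ => rfl
  let m : E ⊕ U → (E ⊕ U → R) := Sum.elim (fun e => Pi.single (Sum.inl e) (x e)) (fun _ => 0)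
  let m2 : E ⊕ U → (E ⊕ U → R) := Sum.elim (fun e => Sum.elim 0 (fun u => B u e)) (fun u => Sum.elim (B u) 0)
  have hQ : Qm B x = (Finset.univ.map (Function.Embedding.inl : E ↪ E ⊕ U)).piecewise (m + m2) m2 := by
    ext i j
    rcases i with i | i <;> rcases j with j | j
    · simp [Qm, m, m2, diagonal_apply, Pi.single_apply, eq_comm, Finset.piecewise]
    · simp [Qm, m, m2, Finset.piecewise]
    · simp [Qm, m2, Finset.piecewise]
    · simp [Qm, m2, Finset.piecewise]
  rw [psi, ← hf, hQ, MultilinearMap.map_piecewise_add]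
  refine Finset.sum_bij' (fun s _ => s.toLeft) (fun S _ => S.map Function.Embedding.inl) ?_ ?_ ?_ ?_ ?_
  · simp
  · intro S _
    simp [Finset.map_subset_map]
  · intro s hs
    rw [Finset.mem_powerset, Finset.subset_map_inl] at hs
    ext i
    rcases i with i | i
    · simp
    · have : Sum.inr i ∉ s := by
        intro h
        have := Finset.mem_toRight.2 h
        rw [hs.2] at this
        simp at this
      simp [this]
  · intro S _
    ext; simp
  · intro s hs
    rw [Finset.mem_powerset, Finset.subset_map_inl] at hs
    obtain ⟨S, rfl⟩ : ∃ S : Finset E, s = S.map Function.Embedding.inl := by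
      refine ⟨s.toLeft, ?_⟩
      ext i
      rcases i with i | i
      · simp
      · have : Sum.inr i ∉ s := by
          intro h
          have := Finset.mem_toRight.2 h
          rw [hs.2] at this
          simp at this
        simp [this]
    have hS : (S.map (Function.Embedding.inl : E ↪ E ⊕ U)).toLeft = S := by ext; simp
    rw [hS, ← det_NS, ← hf]
    let nn : E ⊕ U → (E ⊕ U → R) := fun i j => NS B S i j
    have h2 : (S.map (Function.Embedding.inl : E ↪ E ⊕ U)).piecewise m m2 =
        (S.map (Function.Embedding.inl : E ↪ E ⊕ U)).piecewise
          (fun i => (Sum.elim x (fun _ => 1) i : R) • nn i) nn := by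
      ext i j
      rcases i with i | i
      · by_cases hi : i ∈ S <;> rcases j with j | j <;>
          simp [Finset.piecewise, m, m2, NS, nn, hi, diagonal_apply, Pi.single_apply, eq_comm]
      · rcases j with j | j <;> simp [Finset.piecewise, m2, NS, nn]
    rw [h2, MultilinearMap.map_piecewise_smul, Finset.prod_map]
    rfl

lemma zb_card {T : Type*} [Fintype T] [DecidableEq T] (A : Matrix U T R) (h : Fintype.card T ≠ Fintype.card U) :
    (zb A).det = 0 := by
  by_contra hne
  rw [det_apply] at hne
  obtain ⟨τ, -, hτ⟩ := Finset.exists_ne_zero_of_sum_ne_zero hne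
  have hp : ∏ i, zb A (τ i) i ≠ 0 := by
    intro h0; rw [h0, smul_zero] at hτ; exact hτ rfl
  have hi : ∀ i, zb A (τ i) i ≠ 0 := fun i h0 => hp (Finset.prod_eq_zero (Finset.mem_univ i) h0)
  have h1 : ∀ t : T, ∃ u : U, τ (Sum.inl t) = Sum.inr u := by
    intro t
    rcases hh : τ (Sum.inl t) with a | a
    · exact absurd (by rw [hh]; rfl) (hi (Sum.inl t))
    · exact ⟨a, rfl⟩
  have h2 : ∀ u : U, ∃ t : T, τ (Sum.inr u) = Sum.inl t := by
    intro t
    rcases hh : τ (Sum.inr t) with a | a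
    · exact ⟨a, rfl⟩
    · exact absurd (by rw [hh]; rfl) (hi (Sum.inr t))
  choose f hf using h1
  choose g hg using h2
  have hfi : Function.Injective f := by
    intro a b hab
    have : τ (Sum.inl a) = τ (Sum.inl b) := by rw [hf, hf, hab]
    simpa using this
  have hgi : Function.Injective g := by
    intro a b hab
    have : τ (Sum.inr a) = τ (Sum.inr b) := by rw [hg, hg, hab]
    simpa using this
  exact h (le_antisymm (Fintype.card_le_of_injective f hfi) (Fintype.card_le_of_injective g hgi))

def kap (U : Type*) [Fintype U] [DecidableEq U] : ℤ := (fromBlocks 0 1 1 0 : Matrix (U ⊕ U) (U ⊕ U) ℤ).det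

lemma kap_sq : kap U * kap U = 1 := by
  rw [kap, ← det_mul, fromBlocks_multiply]
  simp

lemma zb_square {T : Type*} [Fintype T] [DecidableEq T] (A : Matrix U T ℤ) (τ : U ≃ T) :
    (zb A).det = kap U * ((A.submatrix id τ).det * (A.submatrix id τ).det) := by
  have h : (zb A).submatrix (Equiv.sumCongr τ (Equiv.refl U)) (Equiv.sumCongr τ (Equiv.refl U)) =
      fromBlocks 0 1 1 0 * fromBlocks (A.submatrix id τ) 0 0 (A.submatrix id τ)ᵀ := by
    rw [fromBlocks_multiply]
    ext i j
    rcases i with i | i <;> rcases j with j | j <;> simp [zb]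
  rw [← det_submatrix_equiv_self (Equiv.sumCongr τ (Equiv.refl U)), h, det_mul, det_fromBlocks_zero₂₁, det_transpose, kap]

end EXPAND
end C2

namespace C2
open Matrix

section TREE
variable {V : Type} [Fintype V] [DecidableEq V] (G : SimpleGraph V) [DecidableRel G.Adj] (c : V)

noncomputable def inc : Matrix {u : V // u ≠ c} ↥G.edgeFinset ℤ :=
  Matrix.of fun u e => (if u.1 = (Quot.out e.1).1 then 1 else 0) - (if u.1 = (Quot.out e.1).2 then 1 else 0)

lemma inc_of (e : ↥G.edgeFinset) (v w : V) (h : e.1 = s(v, w)) :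
    (∀ u, inc G c u e = (if u.1 = v then 1 else 0) - (if u.1 = w then 1 else 0)) ∨
    (∀ u, inc G c u e = (if u.1 = w then 1 else 0) - (if u.1 = v then 1 else 0)) := by
  have h1 : s((Quot.out e.1).1, (Quot.out e.1).2) = s(v, w) := (Quot.out_eq e.1).trans h
  rw [Sym2.eq_iff] at h1
  rcases h1 with ⟨h1, h2⟩ | ⟨h1, h2⟩
  · left; intro u; simp only [inc, of_apply, h1, h2]
  · right; intro u; simp only [inc, of_apply, h1, h2]

variable (S : Finset ↥G.edgeFinset)

def HS : SimpleGraph V := SimpleGraph.fromEdgeSet {e | ∃ t : ↥G.edgeFinset, t ∉ S ∧ t.1 = e}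

noncomputable def AS : Matrix {u : V // u ≠ c} {e : ↥G.edgeFinset // e ∉ S} ℤ := (inc G c).submatrix id Subtype.val

lemma surj_of_reach (v : V) (h : (HS G S).Reachable c v) :
    ∃ z : {e : ↥G.edgeFinset // e ∉ S} → ℤ, ∀ u : {u : V // u ≠ c}, (AS G c S *ᵥ z) u = if u.1 = v then 1 else 0 := by
  rw [SimpleGraph.reachable_iff_reflTransGen] at h
  induction h with
  | refl =>
    refine ⟨0, fun u => ?_⟩
    simp [u.2]
  | @tail v w _ hvw ih =>
    obtain ⟨z, hz⟩ := ih
    obtain ⟨⟨t, ht, hte⟩, hne⟩ := (SimpleGraph.fromEdgeSet_adj _).1 hvw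
    rcases inc_of G c t v w hte with h | h
    · refine ⟨z - Pi.single ⟨t, ht⟩ 1, fun u => ?_⟩
      rw [mulVec_sub, Pi.sub_apply, hz, mulVec_single_one]
      simp only [AS, col_apply, submatrix_apply, id, h]
      ring
    · refine ⟨z + Pi.single ⟨t, ht⟩ 1, fun u => ?_⟩
      rw [mulVec_add, Pi.add_apply, hz, mulVec_single_one]
      simp only [AS, col_apply, submatrix_apply, id, h]
      ring

lemma det_conn (h : (HS G S).Connected) (τ : {u : V // u ≠ c} ≃ {e : ↥G.edgeFinset // e ∉ S}) :
    ((AS G c S).submatrix id τ).det * ((AS G c S).submatrix id τ).det = 1 := by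
  choose z hz using fun v => surj_of_reach G c S v (h.preconnected c v)
  have h1 : (AS G c S).submatrix id τ * (Matrix.of fun i (v : {u : V // u ≠ c}) => z v.1 (τ i)) = 1 := by
    ext u v
    have := hz v.1 u
    rw [mul_apply]
    rw [mulVec, dotProduct, ← Equiv.sum_comp τ] at this
    simp only [submatrix_apply, id, of_apply]
    rw [this, one_apply]
    simp [Subtype.ext_iff]
  have h2 := congrArg det h1
  rw [det_mul, det_one] at h2
  exact Int.isUnit_mul_self (IsUnit.of_mul_eq_one _ h2)

lemma det_disc (h : ¬ (HS G S).Connected) (τ : {u : V // u ≠ c} ≃ {e : ↥G.edgeFinset // e ∉ S}) :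
    ((AS G c S).submatrix id τ).det = 0 := by
  classical
  have : ∃ v, ¬ (HS G S).Reachable c v := by
    by_contra hc
    push Not at hc
    exact h ((SimpleGraph.connected_iff_exists_forall_reachable _).2 ⟨c, hc⟩)
  obtain ⟨v, hv⟩ := this
  have hvc : v ≠ c := by rintro rfl; exact hv (SimpleGraph.Reachable.refl _)
  let y : V → ℤ := fun u => if (HS G S).Reachable c u then 0 else 1
  have hyc : y c = 0 := by simp [y]
  have hsum : ∀ w : V, ∑ u : {u : V // u ≠ c}, y u.1 * (if u.1 = w then 1 else 0) = y w := by
    intro w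
    by_cases hw : w = c
    · subst hw
      rw [hyc]
      refine Finset.sum_eq_zero fun u _ => ?_
      simp [u.2]
    · rw [Finset.sum_eq_single ⟨w, hw⟩]
      · simp
      · intro b _ hb
        have : b.1 ≠ w := fun h => hb (Subtype.ext h)
        simp [this]
      · simp
  rw [← Matrix.exists_vecMul_eq_zero_iff]
  refine ⟨fun u => y u.1, ?_, ?_⟩
  · intro h0
    have := congrFun h0 ⟨v, hvc⟩
    simp [y, hv] at this
  · ext i
    obtain ⟨v, w, hvw⟩ : ∃ v w, (τ i).1.1 = s(v, w) := by
      induction h : (τ i).1.1 with | _ v w => exact ⟨v, w, rfl⟩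
    have hG : G.Adj v w := by
      have := (τ i).1.2
      rw [hvw] at this
      simpa using this
    have hadj : (HS G S).Adj v w := (SimpleGraph.fromEdgeSet_adj _).2 ⟨⟨(τ i).1, (τ i).2, hvw⟩, hG.ne⟩
    have hy : y v = y w := by
      have : (HS G S).Reachable c v ↔ (HS G S).Reachable c w :=
        ⟨fun h => h.trans hadj.reachable, fun h => h.trans hadj.symm.reachable⟩
      simp [y, this]
    simp only [vecMul, dotProduct, AS, submatrix_apply, id, Pi.zero_apply]
    rcases inc_of G c (τ i).1 v w hvw with h | h <;>
      simp only [h, mul_sub, Finset.sum_sub_distrib, hsum, hy, sub_self]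

lemma card_HS : Nat.card (HS G S).edgeSet = Fintype.card {e : ↥G.edgeFinset // e ∉ S} := by
  rw [← Nat.card_eq_fintype_card]
  have hE : (HS G S).edgeSet = {e | ∃ t : ↥G.edgeFinset, t ∉ S ∧ t.1 = e} \ {e | e.IsDiag} :=
    SimpleGraph.edgeSet_fromEdgeSet _
  have hmem : ∀ t : {e : ↥G.edgeFinset // e ∉ S}, t.1.1 ∈ (HS G S).edgeSet := by
    intro t
    rw [hE]
    refine ⟨⟨t.1, t.2, rfl⟩, ?_⟩
    have := t.1.2
    rw [SimpleGraph.mem_edgeFinset] at this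
    exact G.not_isDiag_of_mem_edgeSet this
  refine (Nat.card_congr (Equiv.ofBijective
    (fun t : {e : ↥G.edgeFinset // e ∉ S} => (⟨t.1.1, hmem t⟩ : (HS G S).edgeSet)) ⟨?_, ?_⟩)).symm
  · intro a b hab
    have := congrArg Subtype.val hab
    exact Subtype.ext (Subtype.ext this)
  · rintro ⟨e, he⟩
    have he' := he
    rw [hE] at he'
    obtain ⟨⟨t, ht, rfl⟩, -⟩ := he'
    exact ⟨⟨t, ht⟩, rfl⟩

open Classical in
lemma det_zb_AS : (zb (AS G c S)).det = kap {u : V // u ≠ c} * if (HS G S).IsTree then 1 else 0 := by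
  have hcU : Fintype.card {u : V // u ≠ c} + 1 = Nat.card V := by
    have : 0 < Fintype.card V := Fintype.card_pos_iff.2 ⟨c⟩
    rw [Nat.card_eq_fintype_card, Fintype.card_subtype_compl, Fintype.card_subtype_eq]
    omega
  rw [SimpleGraph.isTree_iff_connected_and_card, card_HS]
  by_cases hcard : Fintype.card {e : ↥G.edgeFinset // e ∉ S} = Fintype.card {u : V // u ≠ c}
  · let τ := Fintype.equivOfCardEq hcard.symm
    rw [zb_square _ τ]
    by_cases hc : (HS G S).Connected
    · rw [det_conn G c S hc, if_pos ⟨hc, by omega⟩]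
    · rw [det_disc G c S hc, if_neg (fun h => hc h.1), mul_zero]
  · rw [zb_card _ hcard, if_neg (fun h => hcard (by omega)), mul_zero]

theorem tree_thm {R : Type*} [CommRing R] (x : ↥G.edgeFinset → R) :
    psi ((inc G c).map (Int.castRingHom R)) x = (kap {u : V // u ≠ c} : R) * aeval x (kirchhoff G) := by
  classical
  have e1 : ∀ S : Finset ↥G.edgeFinset,
      (zb (((inc G c).map (Int.castRingHom R)).submatrix id (Subtype.val : {e // e ∉ S} → ↥G.edgeFinset))).det =
      (((zb (AS G c S)).det : ℤ) : R) := by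
    intro S
    have := RingHom.map_det (Int.castRingHom R) (zb (AS G c S))
    rw [RingHom.mapMatrix_apply, eq_intCast] at this
    rw [this]
    congr 1
    ext i j
    rcases i with i | i <;> rcases j with j | j <;> simp [zb, AS]
  rw [psi_expand]
  simp only [e1, det_zb_AS]
  rw [kirchhoff, map_sum, Finset.mul_sum, Finset.sum_filter]
  have hm : ∀ T : Set (Sym2 V), (T ∈ (do
      let a ← G.edgeFinset.powerset
      pure (↑a : Set (Sym2 V)) : Finset (Set (Sym2 V)))) ↔ ∃ a ∈ G.edgeFinset.powerset, T = ↑a := by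
    intro T
    simp only [Finset.bind_def, Finset.pure_def, Finset.mem_sup, Finset.mem_singleton]
  refine Finset.sum_bij' (fun S _ => {e : Sym2 V | ∃ t : ↥G.edgeFinset, t ∉ S ∧ t.1 = e})
    (fun T _ => Finset.univ.filter (fun e => e.1 ∉ T)) ?_ ?_ ?_ ?_ ?_
  · intro S _
    rw [hm]
    refine ⟨(Finset.univ.filter (fun e => e ∉ S)).map (Function.Embedding.subtype _), ?_, ?_⟩
    · rw [Finset.mem_powerset]
      intro e he
      rw [Finset.mem_map] at he
      obtain ⟨t, -, rfl⟩ := he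
      exact t.2
    · ext e
      simp
  · simp
  · intro S _
    ext e
    have he : (¬ ∃ t : ↥G.edgeFinset, t ∉ S ∧ t.1 = e.1) ↔ e ∈ S := by
      constructor
      · intro h
        by_contra h'
        exact h ⟨e, h', rfl⟩
      · rintro h ⟨t, ht, hte⟩
        exact ht (Subtype.ext hte ▸ h)
    simp only [Finset.mem_filter, Finset.mem_univ, true_and, Set.mem_setOf_eq, he]
  · intro T hT
    rw [hm] at hT
    obtain ⟨a, ha, rfl⟩ := hT
    rw [Finset.mem_powerset] at ha
    ext e
    simp only [Set.mem_setOf_eq, Finset.mem_filter, Finset.mem_univ, true_and, not_not]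
    constructor
    · rintro ⟨t, ht, rfl⟩; exact ht
    · intro he; exact ⟨⟨e, ha he⟩, he, rfl⟩
  · intro S _
    change _ = (if (HS G S).IsTree then _ else _)
    by_cases ht : (HS G S).IsTree
    · rw [if_pos ht, if_pos ht, map_prod]
      simp only [aeval_X]
      push_cast
      rw [mul_one, mul_comm]
      congr 1
      refine Finset.prod_congr ?_ fun _ _ => rfl
      ext e
      have he : (¬ ∃ t : ↥G.edgeFinset, t ∉ S ∧ t.1 = e.1) ↔ e ∈ S := by
        constructor
        · intro h
          by_contra h'
          exact h ⟨e, h', rfl⟩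
        · rintro h ⟨t, ht, hte⟩
          exact ht (Subtype.ext hte ▸ h)
      simp only [Finset.mem_filter, Finset.mem_univ, true_and, Set.mem_setOf_eq, he]
    · rw [if_neg ht, if_neg ht]
      simp

end TREE
end C2

namespace C2
open Matrix

section GR
variable {V : Type} [Fintype V] [DecidableEq V] (G : SimpleGraph V) [DecidableRel G.Adj] (c : V)

lemma inc_sq (u : {u : V // u ≠ c}) (e : ↥G.edgeFinset) (h : u.1 ∈ e.1) : inc G c u e * inc G c u e = 1 := by
  obtain ⟨w, hw⟩ := h
  have hne : u.1 ≠ w := by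
    have := e.2
    rw [hw, SimpleGraph.mem_edgeFinset, SimpleGraph.mem_edgeSet] at this
    exact this.ne
  rcases inc_of G c e u.1 w hw with h | h <;> simp [h, hne]

lemma inc_zero (u : {u : V // u ≠ c}) (e : ↥G.edgeFinset) (h : u.1 ∉ e.1) : inc G c u e = 0 := by
  obtain ⟨v, w, hvw⟩ : ∃ v w, e.1 = s(v, w) := by
    induction h : e.1 with | _ v w => exact ⟨v, w, rfl⟩
  rw [hvw, Sym2.mem_iff, not_or] at h
  rcases inc_of G c e v w hvw with h' | h' <;> simp [h', h.1, h.2]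

lemma rowAt_of {U E : Type*} (B : Matrix U E ℤ) (u0 : U) (F : Finset E) (k : ℕ) (hF : F.card = k)
    (h1 : ∀ e ∈ F, B u0 e * B u0 e = 1) (h0 : ∀ e, e ∉ F → B u0 e = 0) : ∃ t, RowAt k B u0 t := by
  let τ := F.equivFinOfCardEq hF
  refine ⟨fun i => (τ.symm i).1, ?_, fun i => h1 _ (τ.symm i).2, fun e he => h0 e fun hm => he ⟨τ ⟨e, hm⟩, ?_⟩⟩
  · intro i j hij
    exact τ.symm.injective (Subtype.ext hij)
  · simp

lemma row23_of (v a : V) (hac : a ≠ c) (hva : G.Adj v a) (t : Fin 3 → ↥G.edgeFinset)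
    (ht : ∀ e : ↥G.edgeFinset, a ∈ e.1 → ((∃ i, t i = e) ↔ e.1 = s(v, a)))
    (hd : G.degree a = 3 ∨ G.degree a = 4) :
    Row23 ((inc G c).submatrix id (Subtype.val : {e : ↥G.edgeFinset // ¬ ∃ i, t i = e} → ↥G.edgeFinset)) ⟨a, hac⟩ := by
  classical
  let F : Finset {e : ↥G.edgeFinset // ¬ ∃ i, t i = e} := Finset.univ.filter fun e => a ∈ e.1.1
  have hm : F.map ((Function.Embedding.subtype _).trans (Function.Embedding.subtype _)) =
      (G.incidenceFinset a).erase s(v, a) := by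
    ext e
    simp only [F, Finset.mem_map, Finset.mem_filter, Finset.mem_univ, true_and, Finset.mem_erase,
      SimpleGraph.mem_incidenceFinset]
    constructor
    · rintro ⟨x, hx, rfl⟩
      refine ⟨fun h => x.2 ((ht x.1 hx).2 h), ?_, hx⟩
      have := x.1.2
      rwa [SimpleGraph.mem_edgeFinset] at this
    · rintro ⟨hne, he, ha⟩
      have he' : e ∈ G.edgeFinset := by rwa [SimpleGraph.mem_edgeFinset]
      exact ⟨⟨⟨e, he'⟩, fun h => hne ((ht ⟨e, he'⟩ ha).1 h)⟩, ha, rfl⟩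
  have hcard : F.card = G.degree a - 1 := by
    rw [← Finset.card_map, hm, Finset.card_erase_of_mem, SimpleGraph.card_incidenceFinset_eq_degree]
    rw [SimpleGraph.mem_incidenceFinset]
    exact ⟨hva, by simp⟩
  have h1 : ∀ e ∈ F, (inc G c).submatrix id Subtype.val ⟨a, hac⟩ e * (inc G c).submatrix id Subtype.val ⟨a, hac⟩ e = 1 := by
    intro e he
    exact inc_sq G c ⟨a, hac⟩ e.1 (Finset.mem_filter.1 he).2
  have h0 : ∀ e, e ∉ F → (inc G c).submatrix id Subtype.val ⟨a, hac⟩ e = 0 := by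
    intro e he
    exact inc_zero G c ⟨a, hac⟩ e.1 fun h => he (Finset.mem_filter.2 ⟨Finset.mem_univ _, h⟩)
  rcases hd with hd | hd
  · left
    exact rowAt_of _ _ F 2 (by rw [hcard, hd]) h1 h0
  · right
    exact rowAt_of _ _ F 3 (by rw [hcard, hd]) h1 h0

lemma degs (hG : IsPrimitiveDivergent G) :
    (∀ w, G.degree w = 3 ∨ G.degree w = 4) ∧ (∃ v, G.degree v = 3) ∧ 4 ≤ Fintype.card V ∧
      2 * G.edgeFinset.card + 4 = 4 * Fintype.card V := by
  classical
  obtain ⟨-, K, -, hK, -, hKG⟩ := hG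
  have hs : ∀ w : Option V, (∑ y, if K.Adj w y then 1 else 0) = 4 := by
    intro w
    rw [← hK w, ← Finset.card_filter, Set.ncard_eq_toFinset_card']
    congr 1
    ext y
    simp
  have hd : ∀ w : V, (∑ y, if G.Adj w y then 1 else 0) = G.degree w := by
    intro w
    rw [← Finset.card_filter, SimpleGraph.degree, SimpleGraph.neighborFinset_eq_filter]
  have h1 : ∀ w : V, (if K.Adj none (some w) then 1 else 0) + G.degree w = 4 := by
    intro w
    have := hs (some w)
    rw [Fintype.sum_option] at this
    simp only [hKG, hd, K.adj_comm (some w) none] at this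
    exact this
  have h2 : (∑ w : V, if K.Adj none (some w) then 1 else 0) = 4 := by
    have := hs none
    rw [Fintype.sum_option] at this
    simpa using this
  refine ⟨fun w => ?_, ?_, ?_, ?_⟩
  · have := h1 w
    split_ifs at this <;> omega
  · by_contra hc
    push Not at hc
    have : (∑ w : V, if K.Adj none (some w) then 1 else 0) = 0 := by
      refine Finset.sum_eq_zero fun w _ => ?_
      have := h1 w
      have := hc w
      split_ifs at * <;> omega
    omega
  · rw [← Finset.card_filter] at h2
    rw [← h2]
    exact Finset.card_le_univ _
  · rw [← SimpleGraph.sum_degrees_eq_twice_card_edges]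
    have : ∑ w : V, ((if K.Adj none (some w) then 1 else 0) + G.degree w) = ∑ w : V, 4 :=
      Finset.sum_congr rfl fun w _ => h1 w
    rw [Finset.sum_add_distrib, h2] at this
    simp only [Finset.sum_const, Finset.card_univ, smul_eq_mul] at this
    omega

theorem graph_main (hG : IsPrimitiveDivergent G) (p : ℕ) [Fact p.Prime] :
    ∃ c₁ c : ZMod p, ∀ s : ℕ, 1 ≤ s → ∃ k : ℕ, pointCount p s (kirchhoff G) = (p ^ s) ^ 2 * k ∧
      (k : ZMod p) = c₁ * c ^ s := by
  classical
  obtain ⟨hdeg, ⟨v, hv⟩, hV, hE⟩ := degs G hG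
  rw [← SimpleGraph.card_neighborFinset_eq_degree, Finset.card_eq_three] at hv
  obtain ⟨a, b, c, hab, hac, hbc, hN⟩ := hv
  have hadj : ∀ w, G.Adj v w ↔ w = a ∨ w = b ∨ w = c := by
    intro w
    rw [← SimpleGraph.mem_neighborFinset, hN]
    simp
  have hva : G.Adj v a := (hadj a).2 (by simp)
  have hvb : G.Adj v b := (hadj b).2 (by simp)
  have hvc : G.Adj v c := (hadj c).2 (by simp)
  have me : ∀ w, G.Adj v w → s(v, w) ∈ G.edgeFinset := by
    intro w h
    rwa [SimpleGraph.mem_edgeFinset, SimpleGraph.mem_edgeSet]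
  let t : Fin 3 → ↥G.edgeFinset := ![⟨s(v, a), me a hva⟩, ⟨s(v, b), me b hvb⟩, ⟨s(v, c), me c hvc⟩]
  have t0 : (t 0).1 = s(v, a) := rfl
  have t1 : (t 1).1 = s(v, b) := rfl
  have t2 : (t 2).1 = s(v, c) := rfl
  have hrange : ∀ e, (∃ i, t i = e) ↔ (e.1 = s(v, a) ∨ e.1 = s(v, b) ∨ e.1 = s(v, c)) := by
    intro e
    constructor
    · rintro ⟨i, rfl⟩
      fin_cases i
      · exact Or.inl rfl
      · exact Or.inr (Or.inl rfl)
      · exact Or.inr (Or.inr rfl)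
    · rintro (h | h | h)
      · exact ⟨0, Subtype.ext h.symm⟩
      · exact ⟨1, Subtype.ext h.symm⟩
      · exact ⟨2, Subtype.ext h.symm⟩
  have hrow : RowAt 3 (inc G c) ⟨v, hvc.ne⟩ t := by
    refine ⟨?_, ?_, ?_⟩
    · intro i j hij
      have hij' := congrArg Subtype.val hij
      fin_cases i <;> fin_cases j <;> first
        | rfl
        | (exfalso; simp [t, hab, hac, hbc, hab.symm, hac.symm, hbc.symm, hva.ne, hvb.ne, hvc.ne] at hij')
    · intro i
      apply inc_sq
      fin_cases i <;> simp [t]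
    · intro e he
      apply inc_zero
      rintro ⟨w, hw⟩
      apply he
      rw [hrange]
      have := e.2
      rw [hw, SimpleGraph.mem_edgeFinset, SimpleGraph.mem_edgeSet, hadj] at this
      rw [hw]
      rcases this with rfl | rfl | rfl <;> simp
  have hU : Fintype.card {u : V // u ≠ c} = Fintype.card V - 1 := by
    rw [Fintype.card_subtype_compl, Fintype.card_subtype_eq]
  obtain ⟨c₁, c₂, hmain⟩ := main_la p (inc G c) ⟨v, hvc.ne⟩ t hrow ⟨a, hac⟩ ⟨b, hbc⟩
    (fun h => hab (congrArg Subtype.val h)) (fun h => hva.ne (congrArg Subtype.val h))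
    (fun h => hvb.ne (congrArg Subtype.val h))
    (inc_zero G c _ _ (by rw [t0, Sym2.mem_iff]; simp [hvb.ne.symm, hab.symm]))
    (inc_zero G c _ _ (by rw [t2, Sym2.mem_iff]; simp [hvb.ne.symm, hbc]))
    (inc_zero G c _ _ (by rw [t1, Sym2.mem_iff]; simp [hva.ne.symm, hab]))
    (inc_zero G c _ _ (by rw [t2, Sym2.mem_iff]; simp [hva.ne.symm, hac]))
    (row23_of G c v a hac hva t (by
      intro e hae
      rw [hrange]
      refine ⟨?_, Or.inl⟩
      rintro (h | h | h)
      · exact h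
      · rw [h, Sym2.mem_iff] at hae
        rcases hae with h | h
        · exact absurd h hva.ne.symm
        · exact absurd h hab
      · rw [h, Sym2.mem_iff] at hae
        rcases hae with h | h
        · exact absurd h hva.ne.symm
        · exact absurd h hac) (hdeg a))
    (row23_of G c v b hbc hvb t (by
      intro e hae
      rw [hrange]
      refine ⟨?_, fun h => Or.inr (Or.inl h)⟩
      rintro (h | h | h)
      · rw [h, Sym2.mem_iff] at hae
        rcases hae with h | h
        · exact absurd h hvb.ne.symm
        · exact absurd h hab.symm
      · exact h
      · rw [h, Sym2.mem_iff] at hae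
        rcases hae with h | h
        · exact absurd h hvb.ne.symm
        · exact absurd h hbc) (hdeg b))
    (by rw [Fintype.card_coe, hU]; omega) (by rw [hU]; omega)
  refine ⟨c₁, c₂, fun s hs => ?_⟩
  letI : Fintype (GaloisField p s) := Fintype.ofFinite _
  obtain ⟨k, hk, hk'⟩ := hmain s hs (GaloisField p s)
    (by rw [← Nat.card_eq_fintype_card]; exact GaloisField.card p s (by omega))
  refine ⟨k, ?_, hk'⟩
  rw [← hk, pointCount]
  refine Nat.card_congr (Equiv.subtypeEquivRight fun x => ?_)
  rw [tree_thm]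
  have hkap : (kap {u : V // u ≠ c} : GaloisField p s) * (kap {u : V // u ≠ c} : GaloisField p s) = 1 := by
    rw [← Int.cast_mul, kap_sq, Int.cast_one]
  have hne : (kap {u : V // u ≠ c} : GaloisField p s) ≠ 0 := by
    intro h
    rw [h, zero_mul] at hkap
    exact zero_ne_one hkap
  simp [hne]

lemma fin_div (hG : IsPrimitiveDivergent G) (p : ℕ) [Fact p.Prime] (s : ℕ) (hs : 1 ≤ s)
    (h : ∀ c : ZMod p, c ^ s = c) :
    ((pointCount p s (kirchhoff G) / (p ^ s) ^ 2 : ℕ) : ZMod p)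
        = ((pointCount p 1 (kirchhoff G) / p ^ 2 : ℕ) : ZMod p) := by
  obtain ⟨c₁, c, hm⟩ := graph_main G hG p
  obtain ⟨k, hk, hk'⟩ := hm s hs
  obtain ⟨l, hl, hl'⟩ := hm 1 le_rfl
  have hp : 0 < p := (Fact.out : p.Prime).pos
  rw [hk, hl, pow_one, Nat.mul_div_cancel_left _ (by positivity), Nat.mul_div_cancel_left _ (by positivity),
    hk', hl', h, pow_one]
end GR
end C2


/-- For a primitive divergent graph `G`:
(i) for `p = 2` and any `s ≥ 1` with `q = 2^s`, `c₂^{(q)}(G) ≡ c₂^{(2)}(G) (mod 2)`;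
(ii) for any prime `p`, with `s = p` and `q = p^p`, `c₂^{(q)}(G) ≡ c₂^{(p)}(G) (mod p)`. -/
theorem statement2 {V : Type} [Fintype V] [DecidableEq V]
    (G : SimpleGraph V) [DecidableRel G.Adj]
    (hG : IsPrimitiveDivergent G) :
    (∀ s : ℕ, 1 ≤ s →
      4 ∣ pointCount 2 1 (kirchhoff G) →
      (2 ^ s) ^ 2 ∣ pointCount 2 s (kirchhoff G) →
      ((pointCount 2 s (kirchhoff G) / (2 ^ s) ^ 2 : ℕ) : ZMod 2)
        = ((pointCount 2 1 (kirchhoff G) / 4 : ℕ) : ZMod 2)) ∧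
    (∀ (p : ℕ) [Fact p.Prime],
      p ^ 2 ∣ pointCount p 1 (kirchhoff G) →
      (p ^ p) ^ 2 ∣ pointCount p p (kirchhoff G) →
      ((pointCount p p (kirchhoff G) / (p ^ p) ^ 2 : ℕ) : ZMod p)
        = ((pointCount p 1 (kirchhoff G) / p ^ 2 : ℕ) : ZMod p)) := by
  refine ⟨fun s hs _ _ => ?_, fun p _ _ _ => ?_⟩
  · refine C2.fin_div G hG 2 s hs fun c => ?_
    have : c = 0 ∨ c = 1 := by revert c; decide
    rcases this with rfl | rfl
    · exact zero_pow (by omega)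
    · exact one_pow s
  · exact C2.fin_div G hG p p (Fact.out : p.Prime).one_le fun c => ZMod.pow_card c
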